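/- arXiv:2411.08151 — 3 statements merged into one kernel-verified Lean document; each statement's English description precedes it below -/
import Mathlib

section
/- Suppose there exist constants c₁, c₂ > 0 such that for all sufficiently large n and all integers p with 1 ≤ p ≤ n^{2/3}, c₁·(n^{2/3}·p + n) ≤ DDP(n,p) ≤ c₂·(n^{2/3}·p + n). Then there exist constants c₃, c₄ > 0 such that for all sufficiently large N and all integers p with 1 ≤ p ≤ N, c₃·(N^{1/2}·p + N) ≤ UDP(N,p) ≤ c₄·(N^{1/2}·p + N). -/
open Finset

/-- A walk in a directed edge set `F`, given as the list of visited vertices. -/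
def IsWalkOn {V : Type} (F : Finset (V × V)) (s t : V) (l : List V) : Prop :=
  l.Chain' (fun a b => (a, b) ∈ F) ∧ l.head? = some s ∧ l.getLast? = some t

def ReachableOn {V : Type} (F : Finset (V × V)) (s t : V) : Prop :=
  ∃ l, IsWalkOn F s t l

/-- A directed weighted graph: a finite set of directed edges together with weights. -/
structure WDigraph (V : Type) where
  Edge : Finset (V × V)
  w : V × V → ℝ

namespace WDigraph

variable {V : Type}

/-- Total weight of a walk (sum of weights of consecutive pairs). -/
def walkWeight (G : WDigraph V) (l : List V) : ℝ :=
  ((l.zip l.tail).map G.w).sum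

/-- Distance from `s` to `t` using only edges of `F`, with weights of `G`. -/
noncomputable def distOn (G : WDigraph V) (F : Finset (V × V)) (s t : V) : ℝ :=
  sInf {x | ∃ l, IsWalkOn F s t l ∧ G.walkWeight l = x}

def IsWalk (G : WDigraph V) (s t : V) (l : List V) : Prop :=
  IsWalkOn G.Edge s t l

def Reachable (G : WDigraph V) (s t : V) : Prop :=
  ReachableOn G.Edge s t

noncomputable def dist (G : WDigraph V) (s t : V) : ℝ :=
  G.distOn G.Edge s t

/-- All edge weights equal to `1`. -/
def Unweighted (G : WDigraph V) : Prop := ∀ e ∈ G.Edge, G.w e = 1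

/-- All edge weights positive. -/
def PosWeights (G : WDigraph V) : Prop := ∀ e ∈ G.Edge, 0 < G.w e

/-- `F` is (the edge set of) an exact distance preserver of `(G, P)`. -/
def IsExactPreserver (G : WDigraph V) (F : Finset (V × V)) (P : Finset (V × V)) : Prop :=
  F ⊆ G.Edge ∧ ∀ q ∈ P, ReachableOn F q.1 q.2 ∧ G.distOn F q.1 q.2 = G.dist q.1 q.2

/-- Total (in plus out) degree of a vertex. -/
def degree [DecidableEq V] (G : WDigraph V) (v : V) : ℕ :=
  (G.Edge.filter fun e => e.1 = v ∨ e.2 = v).card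

end WDigraph
/-- An undirected weighted graph: a finite set of undirected edges together with weights. -/
structure WGraph (V : Type) where
  Edge : Finset (Sym2 V)
  w : Sym2 V → ℝ

namespace WGraph

variable {V : Type}

def walkWeight (G : WGraph V) (l : List V) : ℝ :=
  ((l.zip l.tail).map fun p => G.w s(p.1, p.2)).sum

def IsWalkOn (F : Finset (Sym2 V)) (s t : V) (l : List V) : Prop :=
  l.Chain' (fun a b => s(a, b) ∈ F) ∧ l.head? = some s ∧ l.getLast? = some t

noncomputable def distOn (G : WGraph V) (F : Finset (Sym2 V)) (s t : V) : ℝ :=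
  sInf {x | ∃ l, IsWalkOn F s t l ∧ G.walkWeight l = x}

def IsWalk (G : WGraph V) (s t : V) (l : List V) : Prop := IsWalkOn G.Edge s t l

def Reachable (G : WGraph V) (s t : V) : Prop := ∃ l, G.IsWalk s t l

noncomputable def dist (G : WGraph V) (s t : V) : ℝ := G.distOn G.Edge s t

def PosWeights (G : WGraph V) : Prop := ∀ e ∈ G.Edge, 0 < G.w e

def Unweighted (G : WGraph V) : Prop := ∀ e ∈ G.Edge, G.w e = 1

def IsExactPreserver (G : WGraph V) (F : Finset (Sym2 V)) (P : Finset (V × V)) : Prop :=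
  F ⊆ G.Edge ∧ ∀ q ∈ P, (∃ l, IsWalkOn F q.1 q.2 l) ∧ G.distOn F q.1 q.2 = G.dist q.1 q.2

end WGraph
/-- Minimum number of edges of an exact distance preserver of a directed graph. -/
noncomputable def minPresD (n : ℕ) (G : WDigraph (Fin n)) (P : Finset (Fin n × Fin n)) : ℕ :=
  sInf {k | ∃ F : Finset (Fin n × Fin n), G.IsExactPreserver F P ∧ F.card = k}

/-- Minimum number of edges of an exact distance preserver of an undirected graph. -/
noncomputable def minPresU (n : ℕ) (G : WGraph (Fin n)) (P : Finset (Fin n × Fin n)) : ℕ :=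
  sInf {k | ∃ F : Finset (Sym2 (Fin n)), G.IsExactPreserver F P ∧ F.card = k}

/-- `DDP n p`: extremal size of directed distance preservers on `n` vertices, `p` demand pairs. -/
noncomputable def DDP (n p : ℕ) : ℕ :=
  sSup {k | ∃ G : WDigraph (Fin n), G.PosWeights ∧
    ∃ P : Finset (Fin n × Fin n), P.card = p ∧ (∀ q ∈ P, G.Reachable q.1 q.2) ∧
      minPresD n G P = k}

/-- `DADP n p`: extremal size of DAG distance preservers on `n` vertices, `p` demand pairs. -/
noncomputable def DADP (n p : ℕ) : ℕ :=
  sSup {k | ∃ G : WDigraph (Fin n), G.PosWeights ∧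
    (∃ f : Fin n → ℕ, ∀ e ∈ G.Edge, f e.1 < f e.2) ∧
    ∃ P : Finset (Fin n × Fin n), P.card = p ∧ (∀ q ∈ P, G.Reachable q.1 q.2) ∧
      minPresD n G P = k}

/-- `UDP n p`: extremal size of undirected distance preservers on `n` vertices, `p` demand pairs. -/
noncomputable def UDP (n p : ℕ) : ℕ :=
  sSup {k | ∃ G : WGraph (Fin n), G.PosWeights ∧
    ∃ P : Finset (Fin n × Fin n), P.card = p ∧ (∀ q ∈ P, G.Reachable q.1 q.2) ∧
      minPresU n G P = k}

section DartPaths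

variable {V K : Type}

/-- `DartPath R s t L`: the darts in the list `L` form a walk from `s` to `t` along `R`. -/
inductive DartPath (R : V → V → Prop) : V → V → List (V × V) → Prop
  | nil (s : V) : DartPath R s s []
  | cons {s u t : V} {L : List (V × V)} :
      R s u → DartPath R u t L → DartPath R s t ((s, u) :: L)

namespace DartPath

variable {R : V → V → Prop} {s t u v : V} {L L₁ L₂ : List (V × V)} {e f : V × V}

theorem eq_of_nil (h : DartPath R s t []) : s = t := by
  cases h; rfl

theorem cons_iff : DartPath R s t (e :: L) ↔ e.1 = s ∧ R s e.2 ∧ DartPath R e.2 t L := by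
  constructor
  · intro h
    cases h with
    | cons h₁ h₂ => exact ⟨rfl, h₁, h₂⟩
  · rintro ⟨rfl, h₁, h₂⟩
    exact .cons h₁ h₂

theorem append_iff : DartPath R s t (L₁ ++ L₂) ↔ ∃ u, DartPath R s u L₁ ∧ DartPath R u t L₂ := by
  induction L₁ generalizing s with
  | nil =>
    constructor
    · intro h
      exact ⟨s, .nil s, h⟩
    · rintro ⟨u, h₁, h₂⟩
      cases h₁
      exact h₂
  | cons e L ih =>
    simp only [List.cons_append, cons_iff, ih]
    constructor
    · rintro ⟨h₁, h₂, u, h₃, h₄⟩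
      exact ⟨u, ⟨h₁, h₂, h₃⟩, h₄⟩
    · rintro ⟨u, ⟨h₁, h₂, h₃⟩, h₄⟩
      exact ⟨h₁, h₂, u, h₃, h₄⟩

theorem append (h₁ : DartPath R s u L₁) (h₂ : DartPath R u t L₂) : DartPath R s t (L₁ ++ L₂) :=
  append_iff.2 ⟨u, h₁, h₂⟩

theorem single (h : R s t) : DartPath R s t [(s, t)] :=
  .cons h (.nil t)

theorem concat_iff : DartPath R s t (L ++ [e]) ↔ DartPath R s e.1 L ∧ R e.1 e.2 ∧ e.2 = t := by
  rw [append_iff]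
  constructor
  · rintro ⟨u, h₁, h₂⟩
    obtain ⟨rfl, h, h'⟩ := cons_iff.1 h₂
    exact ⟨h₁, h, h'.eq_of_nil⟩
  · rintro ⟨h₁, h₂, rfl⟩
    exact ⟨_, h₁, single h₂⟩

theorem rel_of_mem (h : DartPath R s t L) (he : e ∈ L) : R e.1 e.2 := by
  induction h with
  | nil => simp at he
  | cons h₁ _ ih =>
    rcases List.mem_cons.1 he with rfl | he
    · exact h₁
    · exact ih he

theorem of_forall_mem {R' : V → V → Prop} (h : DartPath R s t L)
    (h' : ∀ e ∈ L, R e.1 e.2 → R' e.1 e.2) : DartPath R' s t L := by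
  induction h with
  | nil => exact .nil _
  | cons h₁ _ ih =>
    exact .cons (h' _ List.mem_cons_self h₁) (ih fun e he => h' e (List.mem_cons_of_mem _ he))

theorem reverse (hR : ∀ a b, R a b → R b a) (h : DartPath R s t L) :
    DartPath R t s (L.map Prod.swap).reverse := by
  induction h with
  | nil => exact .nil _
  | cons h₁ _ ih =>
    simp only [List.map_cons, List.reverse_cons]
    exact ih.append (single (hR _ _ h₁))

/-- Splitting a path at two successive darts. -/
theorem exists_split (h : DartPath R s t L) (hef : [e, f].Sublist L) :
    ∃ A B C, L = A ++ e :: (B ++ f :: C) ∧ DartPath R s e.1 A ∧ R e.1 e.2 ∧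
      DartPath R e.2 f.1 B ∧ R f.1 f.2 ∧ DartPath R f.2 t C := by
  obtain ⟨r₁, r₂, rfl, he, hf⟩ := List.cons_sublist_iff.1 hef
  obtain ⟨A, B₁, rfl⟩ := List.append_of_mem he
  obtain ⟨B₂, C, rfl⟩ := List.append_of_mem (List.singleton_sublist.1 hf)
  have h' : DartPath R s t (A ++ e :: ((B₁ ++ B₂) ++ f :: C)) := by
    simpa [List.append_assoc] using h
  refine ⟨A, B₁ ++ B₂, C, by simp, ?_⟩
  obtain ⟨u, hA, h'⟩ := append_iff.1 h'
  obtain ⟨rfl, he', h'⟩ := cons_iff.1 h'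
  obtain ⟨u, hB, h'⟩ := append_iff.1 h'
  obtain ⟨rfl, hf', h'⟩ := cons_iff.1 h'
  exact ⟨hA, he', hB, hf', h'⟩

/-- List walks, described by their visited vertices, are the same as dart paths. -/
theorem of_isChain {l : List V} (h : l.IsChain R) (hs : l.head? = some s)
    (ht : l.getLast? = some t) : DartPath R s t (l.zip l.tail) := by
  induction l generalizing s with
  | nil => simp at hs
  | cons a l ih =>
    obtain rfl : a = s := by simpa using hs
    cases l with
    | nil =>
      obtain rfl : a = t := by simpa using ht
      exact .nil a
    | cons b l =>
      rw [List.isChain_cons_cons] at h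
      exact .cons h.1 (ih h.2 rfl (by simpa using ht))

theorem exists_isChain (h : DartPath R s t L) :
    ∃ l : List V, l.IsChain R ∧ l.head? = some s ∧ l.getLast? = some t ∧ l.zip l.tail = L := by
  induction h with
  | nil s => exact ⟨[s], by simp⟩
  | @cons s u t L h₁ _ ih =>
    obtain ⟨l, hl, hs, ht, rfl⟩ := ih
    cases l with
    | nil => simp at hs
    | cons a l =>
      obtain rfl : a = u := by simpa using hs
      exact ⟨s :: a :: l, List.isChain_cons_cons.2 ⟨h₁, hl⟩, rfl, by simpa using ht, rfl⟩

end DartPath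

theorem List.pair_sublist_or_of_mem {α : Type} {l : List α} {a b : α} (ha : a ∈ l) (hb : b ∈ l)
    (hab : a ≠ b) : [a, b].Sublist l ∨ [b, a].Sublist l := by
  induction l with
  | nil => simp at ha
  | cons c l ih =>
    rcases List.mem_cons.1 ha with rfl | ha'
    · exact .inl (List.Sublist.cons_cons _
        (List.singleton_sublist.2 ((List.mem_cons.1 hb).resolve_left hab.symm)))
    · rcases List.mem_cons.1 hb with rfl | hb'
      · exact .inr (List.Sublist.cons_cons _ (List.singleton_sublist.2 ha'))
      · exact (ih ha' hb').imp (·.cons _) (·.cons _)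

theorem List.nodup_map_iff_forall_sublist {α β : Type} {l : List α} {f : α → β} :
    (l.map f).Nodup ↔ ∀ a b, [a, b].Sublist l → f a ≠ f b := by
  rw [List.Nodup, List.pairwise_map, List.pairwise_iff_forall_sublist]

/-- Total weight of a list of darts. -/
def dartWeight (w : V × V → ℝ) (L : List (V × V)) : ℝ := (L.map w).sum

@[simp] theorem dartWeight_nil (w : V × V → ℝ) : dartWeight w [] = 0 := by
  simp [dartWeight]

@[simp] theorem dartWeight_cons (w : V × V → ℝ) (e : V × V) (L : List (V × V)) :
    dartWeight w (e :: L) = w e + dartWeight w L := by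
  simp [dartWeight]

@[simp] theorem dartWeight_append (w : V × V → ℝ) (L₁ L₂ : List (V × V)) :
    dartWeight w (L₁ ++ L₂) = dartWeight w L₁ + dartWeight w L₂ := by
  simp [dartWeight]

theorem dartWeight_reverse {w : V × V → ℝ} (hw : ∀ e, w e.swap = w e) (L : List (V × V)) :
    dartWeight w (L.map Prod.swap).reverse = dartWeight w L := by
  induction L with
  | nil => simp
  | cons e L ih => simp [ih, hw, add_comm]

/-- Infimum of the weights of the paths from `s` to `t`. -/
noncomputable def pathDist (R : V → V → Prop) (w : V × V → ℝ) (s t : V) : ℝ :=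
  sInf {x | ∃ L, DartPath R s t L ∧ dartWeight w L = x}

/-- `L` is a path from `s` to `t` of minimum weight. -/
def IsOptPath (R : V → V → Prop) (w : V × V → ℝ) (s t : V) (L : List (V × V)) : Prop :=
  DartPath R s t L ∧ ∀ L', DartPath R s t L' → dartWeight w L ≤ dartWeight w L'

/-- All darts along `R` have positive weight. -/
def PosOn (R : V → V → Prop) (w : V × V → ℝ) : Prop := ∀ e : V × V, R e.1 e.2 → 0 < w e

variable {R : V → V → Prop} {w : V × V → ℝ} {s t u v : V} {L M A C : List (V × V)} {e f : V × V}

theorem DartPath.weight_nonneg (hpos : PosOn R w) (h : DartPath R s t L) : 0 ≤ dartWeight w L := by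
  induction h with
  | nil => simp
  | cons h₁ _ ih =>
    rw [dartWeight_cons]
    exact add_nonneg (hpos (_, _) h₁).le ih

theorem DartPath.weight_pos (hpos : PosOn R w) (h : DartPath R s t L) (hL : L ≠ []) :
    0 < dartWeight w L := by
  cases h with
  | nil => simp at hL
  | cons h₁ h₂ =>
    rw [dartWeight_cons]
    exact add_pos_of_pos_of_nonneg (hpos (_, _) h₁) (h₂.weight_nonneg hpos)

theorem bddBelow_pathWeights (hpos : PosOn R w) (s t : V) :
    BddBelow {x | ∃ L, DartPath R s t L ∧ dartWeight w L = x} :=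
  ⟨0, by rintro _ ⟨L, hL, rfl⟩; exact hL.weight_nonneg hpos⟩

theorem pathDist_le (hpos : PosOn R w) (h : DartPath R s t L) :
    pathDist R w s t ≤ dartWeight w L :=
  csInf_le (bddBelow_pathWeights hpos s t) ⟨L, h, rfl⟩

theorem pathDist_nonneg (hpos : PosOn R w) : 0 ≤ pathDist R w s t :=
  Real.sInf_nonneg (by rintro _ ⟨L, hL, rfl⟩; exact hL.weight_nonneg hpos)

theorem IsOptPath.weight_eq (hpos : PosOn R w) (h : IsOptPath R w s t L) :
    dartWeight w L = pathDist R w s t :=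
  le_antisymm (le_csInf ⟨_, L, h.1, rfl⟩ (by rintro _ ⟨L', hL', rfl⟩; exact h.2 L' hL'))
    (pathDist_le hpos h.1)

theorem DartPath.isOptPath (hpos : PosOn R w) (h : DartPath R s t L)
    (hL : dartWeight w L ≤ pathDist R w s t) : IsOptPath R w s t L :=
  ⟨h, fun _ h' => hL.trans (pathDist_le hpos h')⟩

theorem DartPath.exists_nodup (hpos : PosOn R w) (h : DartPath R s t L) :
    ∃ L', L'.Nodup ∧ DartPath R s t L' ∧ dartWeight w L' ≤ dartWeight w L := by
  induction hn : L.length using Nat.strong_induction_on generalizing L with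
  | _ n ih =>
    by_cases hnd : (L.map Prod.fst).Nodup
    · exact ⟨L, hnd.of_map, h, le_rfl⟩
    · rw [List.nodup_map_iff_forall_sublist] at hnd
      push Not at hnd
      obtain ⟨e, f, hef, hfst⟩ := hnd
      obtain ⟨A, B, C, rfl, hA, he, hB, hf, hC⟩ := h.exists_split hef
      have h' : DartPath R s t (A ++ f :: C) :=
        hA.append (by rw [hfst]; exact DartPath.cons_iff.2 ⟨rfl, hf, hC⟩)
      obtain ⟨L', h₁, h₂, h₃⟩ := ih _ (by simp at hn ⊢; omega) h' rfl
      refine ⟨L', h₁, h₂, h₃.trans ?_⟩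
      have := hB.weight_nonneg hpos
      have := hpos e he
      simp only [dartWeight_append, dartWeight_cons]
      linarith

theorem DartPath.exists_isOptPath [Finite V] (hpos : PosOn R w) (h : DartPath R s t L) :
    ∃ L', IsOptPath R w s t L' := by
  have := Fintype.ofFinite V
  classical
  have hfin : {L : List (V × V) | L.Nodup ∧ DartPath R s t L}.Finite :=
    Set.Finite.subset (s := {L : List (V × V) | L.Nodup})
      (inferInstanceAs (Finite {L : List (V × V) // L.Nodup})) fun L hL => hL.1
  obtain ⟨L₀, hL₀, hL₀', -⟩ := h.exists_nodup hpos
  obtain ⟨L', hL', hmin⟩ := Set.exists_min_image _ (dartWeight w) hfin ⟨L₀, hL₀, hL₀'⟩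
  refine ⟨L', hL'.2, fun L'' h'' => ?_⟩
  obtain ⟨L₁, h₁, h₂, h₃⟩ := h''.exists_nodup hpos
  exact (hmin L₁ ⟨h₁, h₂⟩).trans h₃

theorem pathDist_self (hpos : PosOn R w) : pathDist R w s s = 0 :=
  le_antisymm (by simpa using pathDist_le hpos (.nil s)) (pathDist_nonneg hpos)

theorem pathDist_triangle [Finite V] (hpos : PosOn R w) {L₁ L₂ : List (V × V)}
    (h₁ : DartPath R s u L₁) (h₂ : DartPath R u t L₂) :
    pathDist R w s t ≤ pathDist R w s u + pathDist R w u t := by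
  obtain ⟨M₁, hM₁⟩ := h₁.exists_isOptPath hpos
  obtain ⟨M₂, hM₂⟩ := h₂.exists_isOptPath hpos
  rw [← hM₁.weight_eq hpos, ← hM₂.weight_eq hpos, ← dartWeight_append]
  exact pathDist_le hpos (hM₁.1.append hM₂.1)

namespace IsOptPath

theorem middle (h : IsOptPath R w s t (A ++ M ++ C)) (hA : DartPath R s u A)
    (hM : DartPath R u v M) (hC : DartPath R v t C) : IsOptPath R w u v M := by
  refine ⟨hM, fun M' hM' => ?_⟩
  have := h.2 _ ((hA.append hM').append hC)
  simp only [dartWeight_append] at this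
  linarith

theorem replace {M' : List (V × V)} (h : IsOptPath R w s t (A ++ M ++ C)) (hA : DartPath R s u A)
    (hM : DartPath R u v M) (hC : DartPath R v t C) (hM' : IsOptPath R w u v M') :
    IsOptPath R w s t (A ++ M' ++ C) := by
  refine ⟨(hA.append hM'.1).append hC, fun L' hL' => le_trans ?_ (h.2 L' hL')⟩
  have := hM'.2 _ hM
  simp only [dartWeight_append]
  linarith

theorem eq_nil_of_loop (hpos : PosOn R w) (h : IsOptPath R w s t (A ++ M ++ C))
    (hA : DartPath R s u A) (hM : DartPath R u u M) (hC : DartPath R u t C) : M = [] := by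
  by_contra hne
  have h₁ := h.2 _ (hA.append hC)
  have h₂ := hM.weight_pos hpos hne
  simp only [dartWeight_append] at h₁
  linarith

theorem reverse (hR : ∀ a b, R a b → R b a) (hw : ∀ e, w e.swap = w e)
    (h : IsOptPath R w s t L) : IsOptPath R w t s (L.map Prod.swap).reverse := by
  refine ⟨h.1.reverse hR, fun L' hL' => ?_⟩
  rw [dartWeight_reverse hw, ← dartWeight_reverse hw L']
  exact h.2 _ (hL'.reverse hR)

/-- Between two successive darts of an optimal path lies an optimal path. -/
theorem exists_between (h : IsOptPath R w s t L) (hef : [e, f].Sublist L) :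
    ∃ A B C, L = A ++ (B ++ [f]) ++ C ∧ e ∈ A ∧ DartPath R s e.2 A ∧
      IsOptPath R w e.2 f.2 (B ++ [f]) ∧ DartPath R f.2 t C := by
  obtain ⟨A, B, C, rfl, hA, he, hB, hf, hC⟩ := h.1.exists_split hef
  have hA' : DartPath R s e.2 (A ++ [e]) := hA.append (.single he)
  have hB' : DartPath R e.2 f.2 (B ++ [f]) := hB.append (.single hf)
  have heq : A ++ e :: (B ++ f :: C) = (A ++ [e]) ++ (B ++ [f]) ++ C := by simp
  exact ⟨A ++ [e], B, C, heq, by simp, hA', (heq ▸ h).middle hA' hB' hC, hC⟩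

theorem nodup_map_fst (hpos : PosOn R w) (h : IsOptPath R w s t L) :
    (L.map Prod.fst).Nodup := by
  rw [List.nodup_map_iff_forall_sublist]
  intro e f hef hfst
  obtain ⟨A, B, C, rfl, hA, he, hB, hf, hC⟩ := h.1.exists_split hef
  have := eq_nil_of_loop (A := A) (M := e :: B) (C := f :: C) hpos (by simpa using h) hA
    (by rw [hfst] at he ⊢; exact DartPath.cons_iff.2 ⟨hfst, he, hB⟩)
    (by rw [hfst]; exact DartPath.cons_iff.2 ⟨rfl, hf, hC⟩)
  simp at this

theorem nodup_map_snd (hpos : PosOn R w) (h : IsOptPath R w s t L) :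
    (L.map Prod.snd).Nodup := by
  rw [List.nodup_map_iff_forall_sublist]
  intro e f hef hsnd
  obtain ⟨A, B, C, rfl, -, hA, hB, hC⟩ := h.exists_between hef
  have := eq_nil_of_loop hpos h hA (hsnd ▸ hB.1) (hsnd ▸ hC)
  simp at this

theorem eq_of_fst_eq (hpos : PosOn R w) (h : IsOptPath R w s t L) (he : e ∈ L) (hf : f ∈ L)
    (hef : e.1 = f.1) : e = f :=
  List.inj_on_of_nodup_map (h.nodup_map_fst hpos) he hf hef

theorem eq_of_snd_eq (hpos : PosOn R w) (h : IsOptPath R w s t L) (he : e ∈ L) (hf : f ∈ L)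
    (hef : e.2 = f.2) : e = f :=
  List.inj_on_of_nodup_map (h.nodup_map_snd hpos) he hf hef

/-- An optimal path uses every edge at most once, in either direction. -/
theorem nodup_map_edge (hpos : PosOn R w) {κ : V × V → K}
    (hκ : ∀ e f, κ e = κ f → e = f ∨ e = f.swap) (h : IsOptPath R w s t L) :
    (L.map κ).Nodup := by
  rw [List.nodup_map_iff_forall_sublist]
  intro e f hef hk
  rcases hκ e f hk with rfl | rfl
  · exact List.nodup_map_iff_forall_sublist.1 (h.nodup_map_fst hpos) _ _ hef rfl
  · obtain ⟨A, B, C, rfl, hA, he, hB, hf, hC⟩ := h.1.exists_split hef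
    have := eq_nil_of_loop (A := A) (M := f.swap :: B ++ [f]) (C := C) hpos (by simpa using h) hA
      (DartPath.append (DartPath.cons_iff.2 ⟨rfl, he, hB⟩) (.single hf)) hC
    simp at this

/-- A segment of an optimal path ending with an edge used by all optimal paths may be rerouted
only through that edge. -/
theorem mem_of_forall_mem (hpos : PosOn R w) {κ : V × V → K}
    (hκ : ∀ e f, κ e = κ f → e = f ∨ e = f.swap) (h : IsOptPath R w s t L)
    (hcrit : ∀ L', IsOptPath R w s t L' → κ f ∈ L'.map κ) (hef : [e, f].Sublist L)
    (hM : IsOptPath R w e.2 f.2 M) : κ f ∈ M.map κ := by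
  obtain ⟨A, B, C, rfl, -, hA, hB, hC⟩ := h.exists_between hef
  have h' := hcrit _ (h.replace hA hB.1 hC hM)
  have hnd := h.nodup_map_edge hpos hκ
  simp only [List.map_append, List.map_cons, List.map_nil, List.mem_append] at h' hnd ⊢
  rcases h' with (h' | h') | h'
  · exact absurd (List.disjoint_of_nodup_append hnd.of_append_left h') (by simp)
  · exact h'
  · exact absurd (List.disjoint_of_nodup_append hnd (a := κ f) (by simp)) (by simpa using h')

end IsOptPath

end DartPaths

section Preservers

variable {V K : Type}

/-- Adjacency through the edge set `F`, where the dart `e` lies on the edge `κ e`. -/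
def EdgeRel (κ : V × V → K) (F : Finset K) (a b : V) : Prop := κ (a, b) ∈ F

/-- Distance preservers, uniformly for directed and undirected graphs. -/
def IsPreserver (κ : V × V → K) (ω : K → ℝ) (E F : Finset K) (P : Finset (V × V)) : Prop :=
  F ⊆ E ∧ ∀ q ∈ P, (∃ L, DartPath (EdgeRel κ F) q.1 q.2 L) ∧
    pathDist (EdgeRel κ F) (ω ∘ κ) q.1 q.2 = pathDist (EdgeRel κ E) (ω ∘ κ) q.1 q.2

/-- A family of optimal paths for the demand pairs `P` in which every edge `k` of `F` is owned by
a demand pair all of whose optimal paths use `k`; `dart k` is the orientation of `k` along the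
chosen path of its owner. -/
structure CriticalSystem (κ : V × V → K) (ω : K → ℝ) (F : Finset K) (P : Finset (V × V)) where
  owner : K → V × V
  dart : K → V × V
  path : V × V → List (V × V)
  isOptPath : ∀ q ∈ P, IsOptPath (EdgeRel κ F) (ω ∘ κ) q.1 q.2 (path q)
  owner_mem : ∀ k ∈ F, owner k ∈ P
  dart_mem : ∀ k ∈ F, dart k ∈ path (owner k)
  map_dart : ∀ k ∈ F, κ (dart k) = k
  critical : ∀ k ∈ F, ∀ L, IsOptPath (EdgeRel κ F) (ω ∘ κ) (owner k).1 (owner k).2 L →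
    k ∈ L.map κ

variable {κ : V × V → K} {ω : K → ℝ} {E F : Finset K} {P : Finset (V × V)}

theorem posOn_edgeRel (hω : ∀ k ∈ E, 0 < ω k) (hF : F ⊆ E) : PosOn (EdgeRel κ F) (ω ∘ κ) :=
  fun _ he => hω _ (hF he)

theorem DartPath.edgeRel_mono {s t : V} {L : List (V × V)} (hF : F ⊆ E)
    (h : DartPath (EdgeRel κ F) s t L) : DartPath (EdgeRel κ E) s t L :=
  h.of_forall_mem fun _ _ h' => hF h'

theorem isPreserver_self (hP : ∀ q ∈ P, ∃ L, DartPath (EdgeRel κ E) q.1 q.2 L) :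
    IsPreserver κ ω E E P :=
  ⟨Finset.Subset.refl E, fun q hq => ⟨hP q hq, rfl⟩⟩

theorem IsPreserver.exists_criticalSystem [Finite V] [Nonempty V] (hω : ∀ k ∈ E, 0 < ω k)
    (hF : IsPreserver κ ω E F P)
    (hmin : ∀ F', IsPreserver κ ω E F' P → F.card ≤ F'.card) :
    Nonempty (CriticalSystem κ ω F P) := by
  classical
  have hpos := posOn_edgeRel (κ := κ) hω hF.1
  have hcrit : ∀ k ∈ F, ∃ q ∈ P, ∀ L, IsOptPath (EdgeRel κ F) (ω ∘ κ) q.1 q.2 L →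
      k ∈ L.map κ := by
    intro k hk
    by_contra! hcon
    have hsub : F.erase k ⊆ E := (Finset.erase_subset _ _).trans hF.1
    have hpos' := posOn_edgeRel (κ := κ) hω hsub
    refine absurd (hmin (F.erase k) ⟨hsub, fun q hq => ?_⟩)
      (not_le.2 (Finset.card_erase_lt_of_mem hk))
    obtain ⟨L, hL, hkL⟩ := hcon q hq
    have hL' : DartPath (EdgeRel κ (F.erase k)) q.1 q.2 L :=
      hL.1.of_forall_mem fun e he h =>
        Finset.mem_erase.2 ⟨fun h' => hkL (List.mem_map.2 ⟨e, he, h'⟩), h⟩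
    refine ⟨⟨L, hL'⟩, le_antisymm ?_ ?_⟩
    · rw [← (hF.2 q hq).2, ← hL.weight_eq hpos]
      exact pathDist_le hpos' hL'
    · refine le_csInf ⟨_, L, hL', rfl⟩ ?_
      rintro _ ⟨M, hM, rfl⟩
      exact pathDist_le (posOn_edgeRel hω (Finset.Subset.refl E)) (hM.edgeRel_mono hsub)
  have hpath : ∀ q ∈ P, ∃ L, IsOptPath (EdgeRel κ F) (ω ∘ κ) q.1 q.2 L := fun q hq =>
    (hF.2 q hq).1.choose_spec.exists_isOptPath hpos
  choose! path hpath using hpath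
  choose! owner howner hcrit using hcrit
  have hdart : ∀ k ∈ F, ∃ e, e ∈ path (owner k) ∧ κ e = k := fun k hk =>
    List.mem_map.1 (hcrit k hk _ (hpath _ (howner k hk)))
  choose! dart hdart₁ hdart₂ using hdart
  exact ⟨⟨owner, dart, path, hpath, howner, hdart₁, hdart₂, hcrit⟩⟩

theorem exists_criticalSystem [Finite V] [Nonempty V] (hω : ∀ k ∈ E, 0 < ω k)
    (hP : ∀ q ∈ P, ∃ L, DartPath (EdgeRel κ E) q.1 q.2 L) :
    ∃ F, F ⊆ E ∧ F.card = sInf {k | ∃ F, IsPreserver κ ω E F P ∧ F.card = k} ∧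
      Nonempty (CriticalSystem κ ω F P) := by
  obtain ⟨F, hF, hcard⟩ := Nat.sInf_mem
    (s := {k | ∃ F, IsPreserver κ ω E F P ∧ F.card = k}) ⟨_, E, isPreserver_self hP, rfl⟩
  refine ⟨F, hF.1, hcard, hF.exists_criticalSystem hω fun F' hF' => ?_⟩
  rw [hcard]
  exact Nat.sInf_le ⟨F', hF', rfl⟩

/-- The edge underlying a dart. -/
abbrev edgeOf (e : V × V) : Sym2 V := s(e.1, e.2)

theorem edgeOf_eq_imp {V : Type} (e f : V × V) (h : edgeOf e = edgeOf f) : e = f ∨ e = f.swap := by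
  rcases Sym2.eq_iff.1 h with ⟨h₁, h₂⟩ | ⟨h₁, h₂⟩
  · exact .inl (Prod.ext h₁ h₂)
  · exact .inr (Prod.ext h₁ h₂)

theorem exists_isChain_iff (R : V → V → Prop) (s t : V) (p : List (V × V) → Prop) :
    (∃ l : List V, (l.IsChain R ∧ l.head? = some s ∧ l.getLast? = some t) ∧ p (l.zip l.tail)) ↔
      ∃ L, DartPath R s t L ∧ p L := by
  constructor
  · rintro ⟨l, ⟨h₁, h₂, h₃⟩, h⟩
    exact ⟨_, .of_isChain h₁ h₂ h₃, h⟩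
  · rintro ⟨L, hL, h⟩
    obtain ⟨l, h₁, h₂, h₃, rfl⟩ := hL.exists_isChain
    exact ⟨l, ⟨h₁, h₂, h₃⟩, h⟩

theorem WDigraph.reachableOn_iff (F : Finset (V × V)) (s t : V) :
    ReachableOn F s t ↔ ∃ L, DartPath (EdgeRel id F) s t L := by
  have := exists_isChain_iff (EdgeRel id F) s t fun _ => True
  simp only [and_true] at this
  exact this

theorem WDigraph.distOn_eq (G : WDigraph V) (F : Finset (V × V)) (s t : V) :
    G.distOn F s t = pathDist (EdgeRel id F) (G.w ∘ id) s t := by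
  refine congrArg sInf (Set.ext fun x => ?_)
  exact exists_isChain_iff (EdgeRel id F) s t fun L => dartWeight G.w L = x

theorem WDigraph.isExactPreserver_iff (G : WDigraph V) (F P : Finset (V × V)) :
    G.IsExactPreserver F P ↔ IsPreserver id G.w G.Edge F P := by
  simp only [WDigraph.IsExactPreserver, IsPreserver, WDigraph.reachableOn_iff, WDigraph.distOn_eq,
    WDigraph.dist]

theorem WGraph.exists_isWalkOn_iff (F : Finset (Sym2 V)) (s t : V) :
    (∃ l, WGraph.IsWalkOn F s t l) ↔ ∃ L, DartPath (EdgeRel edgeOf F) s t L := by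
  have := exists_isChain_iff (EdgeRel edgeOf F) s t fun _ => True
  simp only [and_true] at this
  exact this

theorem WGraph.distOn_eq (G : WGraph V) (F : Finset (Sym2 V)) (s t : V) :
    G.distOn F s t = pathDist (EdgeRel edgeOf F) (G.w ∘ edgeOf) s t := by
  refine congrArg sInf (Set.ext fun x => ?_)
  exact exists_isChain_iff (EdgeRel edgeOf F) s t fun L => dartWeight (G.w ∘ edgeOf) L = x

theorem WGraph.isExactPreserver_iff (G : WGraph V) (F : Finset (Sym2 V)) (P : Finset (V × V)) :
    G.IsExactPreserver F P ↔ IsPreserver edgeOf G.w G.Edge F P := by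
  simp only [WGraph.IsExactPreserver, IsPreserver, WGraph.exists_isWalkOn_iff, WGraph.distOn_eq,
    WGraph.dist]

theorem WGraph.exists_criticalSystem {n : ℕ} [NeZero n] (G : WGraph (Fin n)) (hG : G.PosWeights)
    (P : Finset (Fin n × Fin n)) (hP : ∀ q ∈ P, G.Reachable q.1 q.2) :
    ∃ F, F ⊆ G.Edge ∧ F.card = minPresU n G P ∧ Nonempty (CriticalSystem edgeOf G.w F P) := by
  simp only [minPresU, WGraph.isExactPreserver_iff]
  exact _root_.exists_criticalSystem hG fun q hq => (WGraph.exists_isWalkOn_iff _ _ _).1 (hP q hq)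

theorem WDigraph.exists_criticalSystem {n : ℕ} [NeZero n] (G : WDigraph (Fin n))
    (hG : G.PosWeights) (P : Finset (Fin n × Fin n)) (hP : ∀ q ∈ P, G.Reachable q.1 q.2) :
    ∃ F, F ⊆ G.Edge ∧ F.card = minPresD n G P ∧ Nonempty (CriticalSystem id G.w F P) := by
  simp only [minPresD, WDigraph.isExactPreserver_iff]
  exact _root_.exists_criticalSystem hG fun q hq => (WDigraph.reachableOn_iff _ _ _).1 (hP q hq)

end Preservers

namespace CriticalSystem

variable {V K : Type} {κ : V × V → K} {ω : K → ℝ} {F : Finset K} {P : Finset (V × V)}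

theorem isOptPath_owner (S : CriticalSystem κ ω F P) {k : K} (hk : k ∈ F) :
    IsOptPath (EdgeRel κ F) (ω ∘ κ) (S.owner k).1 (S.owner k).2 (S.path (S.owner k)) :=
  S.isOptPath _ (S.owner_mem k hk)

/-- Edges with the same owner and the same head coincide. -/
theorem eq_of_owner_eq (S : CriticalSystem κ ω F P) (hω : ∀ k ∈ F, 0 < ω k) {k l : K}
    (hk : k ∈ F) (hl : l ∈ F) (ho : S.owner k = S.owner l) (hd : (S.dart k).2 = (S.dart l).2) :
    k = l := by
  rw [← S.map_dart k hk, ← S.map_dart l hl]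
  exact congrArg κ ((S.isOptPath_owner hk).eq_of_snd_eq (posOn_edgeRel hω (Finset.Subset.refl F))
    (S.dart_mem k hk) (ho ▸ S.dart_mem l hl) hd)

/-- The squares of the in-degrees sum up to the number of pairs of edges with a common head. -/
theorem sq_card_le [Fintype V] [DecidableEq V] (F : Finset K) (hd : K → V) :
    F.card ^ 2 ≤ Fintype.card V * ((F ×ˢ F).filter fun x => hd x.1 = hd x.2).card := by
  have h₁ : F.card = ∑ v : V, (F.filter fun k => hd k = v).card :=
    Finset.card_eq_sum_card_fiberwise fun _ _ => Finset.mem_univ _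
  have h₂ : ((F ×ˢ F).filter fun x => hd x.1 = hd x.2).card =
      ∑ v : V, (F.filter fun k => hd k = v).card ^ 2 := by
    rw [Finset.card_eq_sum_card_fiberwise (f := fun x => hd x.1) (t := Finset.univ)
      fun _ _ => Finset.mem_univ _]
    refine Finset.sum_congr rfl fun v _ => ?_
    rw [sq, ← Finset.card_product]
    congr 1
    ext x
    simp only [Finset.mem_filter, Finset.mem_product]
    constructor
    · rintro ⟨⟨⟨h₁, h₂⟩, h₃⟩, h₄⟩
      exact ⟨⟨h₁, h₄⟩, h₂, h₃ ▸ h₄⟩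
    · rintro ⟨⟨h₁, h₂⟩, h₃, h₄⟩
      exact ⟨⟨⟨h₁, h₃⟩, h₂.trans h₄.symm⟩, h₂⟩
  rw [h₁, h₂]
  exact sq_sum_le_card_mul_sum_sq

variable {ω : Sym2 V → ℝ} {F : Finset (Sym2 V)}

/-- Two vertices on an undirected optimal path are joined by an optimal path along it. -/
theorem exists_undirected_between {R : V → V → Prop} {w : V × V → ℝ} {s t : V}
    {L : List (V × V)} {e f : V × V} (hR : ∀ a b, R a b → R b a) (hw : ∀ e, w e.swap = w e)
    (h : IsOptPath R w s t L) (he : e ∈ L) (hf : f ∈ L) (hef : e ≠ f) :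
    ∃ M, IsOptPath R w e.2 f.2 M ∧ ∀ x ∈ M.map edgeOf, x ∈ L.map edgeOf := by
  rcases List.pair_sublist_or_of_mem he hf hef with hs | hs
  · obtain ⟨A, B, C, rfl, -, -, hB, -⟩ := h.exists_between hs
    refine ⟨_, hB, fun x hx => ?_⟩
    simp only [List.map_append, List.mem_append] at hx ⊢
    exact .inl (.inr hx)
  · obtain ⟨A, B, C, rfl, -, -, hB, -⟩ := h.exists_between hs
    refine ⟨_, hB.reverse hR hw, fun x hx => ?_⟩
    obtain ⟨y, hy, rfl⟩ := List.mem_map.1 hx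
    obtain ⟨z, hz, rfl⟩ := List.mem_map.1 (List.mem_reverse.1 hy)
    refine List.mem_map.2 ⟨z, List.mem_append_left _ (List.mem_append_right _ hz), Sym2.eq_swap⟩

theorem edgeRel_symm (a b : V) (h : EdgeRel edgeOf F a b) : EdgeRel edgeOf F b a := by
  have : edgeOf (b, a) = edgeOf (a, b) := Sym2.eq_swap
  rwa [EdgeRel, this]

theorem comp_edgeOf_swap (e : V × V) : (ω ∘ edgeOf) e.swap = (ω ∘ edgeOf) e :=
  congrArg ω Sym2.eq_swap

/-- A pair of owners branches at most once in an undirected graph. -/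
theorem head_eq_of_branching (S : CriticalSystem edgeOf ω F P) (hω : ∀ k ∈ F, 0 < ω k)
    {k k' l l' : Sym2 V} (hk : k ∈ F) (hk' : k' ∈ F) (hl : l ∈ F) (hl' : l' ∈ F)
    (hkk : (S.dart k).2 = (S.dart k').2) (hll : (S.dart l).2 = (S.dart l').2)
    (ho : S.owner k = S.owner l) (ho' : S.owner k' = S.owner l')
    (hnk : k' ∉ (S.path (S.owner k)).map edgeOf) (hnl : l' ∉ (S.path (S.owner l)).map edgeOf) :
    (S.dart k).2 = (S.dart l).2 := by
  by_contra hne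
  have hpos : PosOn (EdgeRel edgeOf F) (ω ∘ edgeOf) := posOn_edgeRel hω (Finset.Subset.refl F)
  wlog hs : [S.dart k', S.dart l'].Sublist (S.path (S.owner k')) generalizing k k' l l'
  · have hne' : S.dart k' ≠ S.dart l' := fun h => hne (by rw [hkk, hll, h])
    refine this hl hl' hk hk' hll hkk ho.symm ho'.symm hnl hnk (Ne.symm hne) ?_
    rw [← ho']
    exact (List.pair_sublist_or_of_mem (S.dart_mem k' hk') (ho' ▸ S.dart_mem l' hl')
      hne').resolve_left hs
  obtain ⟨M, hM, hML⟩ := exists_undirected_between edgeRel_symm comp_edgeOf_swap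
    (S.isOptPath_owner hk) (S.dart_mem k hk) (ho ▸ S.dart_mem l hl) fun h => hne (by rw [h])
  refine hnl (ho ▸ hML l' ?_)
  rw [← S.map_dart l' hl']
  refine (S.isOptPath_owner hk').mem_of_forall_mem hpos edgeOf_eq_imp (fun L' hL' => ?_) hs
    (hkk ▸ hll ▸ hM)
  rw [S.map_dart l' hl']
  exact S.critical l' hl' L' (ho' ▸ hL')

theorem sq_card_undirected_le [Fintype V] (S : CriticalSystem edgeOf ω F P)
    (hω : ∀ k ∈ F, 0 < ω k) :
    F.card ^ 2 ≤ Fintype.card V * (P.card ^ 2 + 2 * F.card) := by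
  classical
  have hpos : PosOn (EdgeRel edgeOf F) (ω ∘ edgeOf) := posOn_edgeRel hω (Finset.Subset.refl F)
  refine (sq_card_le F fun k => (S.dart k).2).trans (Nat.mul_le_mul_left _ ?_)
  rw [← Finset.card_filter_add_card_filter_not
    (fun x : Sym2 V × Sym2 V => x.2 ∉ (S.path (S.owner x.1)).map edgeOf)]
  refine Nat.add_le_add ?_ ?_
  · rw [sq, ← Finset.card_product]
    refine Finset.card_le_card_of_injOn (fun x => (S.owner x.1, S.owner x.2)) ?_ ?_
    · intro x hx
      simp only [Finset.mem_coe, Finset.mem_filter, Finset.mem_product] at hx ⊢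
      exact ⟨S.owner_mem _ hx.1.1.1, S.owner_mem _ hx.1.1.2⟩
    · rintro ⟨k, k'⟩ hx ⟨l, l'⟩ hy hxy
      simp only [Finset.mem_coe, Finset.mem_filter, Finset.mem_product] at hx hy
      obtain ⟨⟨⟨hk, hk'⟩, hkk⟩, hnk⟩ := hx
      obtain ⟨⟨⟨hl, hl'⟩, hll⟩, hnl⟩ := hy
      obtain ⟨ho, ho'⟩ := Prod.ext_iff.1 hxy
      have hv := S.head_eq_of_branching hω hk hk' hl hl' hkk hll ho ho' hnk hnl
      exact Prod.ext (S.eq_of_owner_eq hω hk hl ho hv)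
        (S.eq_of_owner_eq hω hk' hl' ho' (hkk.symm.trans (hv.trans hll)))
  · refine Finset.card_le_mul_card_image_of_maps_to (f := Prod.fst) (t := F) ?_ 2 ?_
    · intro x hx
      simp only [Finset.mem_filter, Finset.mem_product] at hx
      exact hx.1.1.1
    · intro k hk
      have hsub : (Finset.filter (fun x : Sym2 V × Sym2 V => x.1 = k)
          (((F ×ˢ F).filter fun x => (S.dart x.1).2 = (S.dart x.2).2).filter
            fun x => ¬ x.2 ∉ (S.path (S.owner x.1)).map edgeOf)) ⊆
          ({k} ×ˢ F.filter fun l => (S.dart k).2 = (S.dart l).2 ∧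
              S.dart l ∈ S.path (S.owner k)) ∪
          ({k} ×ˢ F.filter fun l => (S.dart k).2 = (S.dart l).2 ∧
              (S.dart l).swap ∈ S.path (S.owner k)) := by
        rintro ⟨x, l⟩ hx
        simp only [Finset.mem_filter, Finset.mem_product, not_not] at hx
        obtain ⟨⟨⟨⟨-, hl⟩, hkl⟩, hmem⟩, rfl⟩ := hx
        obtain ⟨e, he, hel⟩ := List.mem_map.1 hmem
        simp only [Finset.mem_union, Finset.mem_product, Finset.mem_filter, Finset.mem_singleton,
          true_and]
        rcases edgeOf_eq_imp e (S.dart l) (hel.trans (S.map_dart l hl).symm) with rfl | rfl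
        · exact .inl ⟨hl, hkl, he⟩
        · exact .inr ⟨hl, hkl, he⟩
      refine (Finset.card_le_card hsub).trans ((Finset.card_union_le _ _).trans ?_)
      simp only [Finset.card_product, Finset.card_singleton, one_mul]
      have hinj : ∀ l ∈ F, ∀ l' ∈ F, S.dart l = S.dart l' → l = l' := fun l hl l' hl' h => by
        rw [← S.map_dart l hl, h, S.map_dart l' hl']
      refine Nat.add_le_add (b := 1) (d := 1) ?_ ?_ <;>
      · rw [Finset.card_le_one]
        intro l hl l' hl'
        simp only [Finset.mem_filter] at hl hl'
        refine hinj l hl.1 l' hl'.1 ?_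
        first
        | exact (S.isOptPath_owner hk).eq_of_snd_eq hpos hl.2.2 hl'.2.2
            (hl.2.1.symm.trans hl'.2.1)
        | exact Prod.swap_injective ((S.isOptPath_owner hk).eq_of_fst_eq hpos hl.2.2 hl'.2.2
            (hl.2.1.symm.trans hl'.2.1))

end CriticalSystem

theorem minPresU_le {N : ℕ} (hN : 1 ≤ N) {G : WGraph (Fin N)} (hG : G.PosWeights)
    {P : Finset (Fin N × Fin N)} (hP : ∀ q ∈ P, G.Reachable q.1 q.2) :
    (minPresU N G P : ℝ) ≤ √N * P.card + 2 * N := by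
  have : NeZero N := ⟨by omega⟩
  obtain ⟨F, hF, hcard, ⟨S⟩⟩ := G.exists_criticalSystem hG P hP
  have h := S.sq_card_undirected_le fun k hk => hG k (hF hk)
  rw [Fintype.card_fin, hcard] at h
  have h' : (minPresU N G P : ℝ) ^ 2 ≤ N * (P.card ^ 2 + 2 * minPresU N G P) := by exact_mod_cast h
  by_contra! hlt
  have hs := Real.sq_sqrt (Nat.cast_nonneg (α := ℝ) N)
  have hs' := Real.sqrt_nonneg (N : ℝ)
  have hc : (0 : ℝ) ≤ P.card := Nat.cast_nonneg _
  have hN' : (0 : ℝ) ≤ N := Nat.cast_nonneg _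
  set m : ℝ := (minPresU N G P : ℝ)
  have h₁ : (√N * P.card) ^ 2 < (m - 2 * N) ^ 2 :=
    pow_lt_pow_left₀ (by linarith) (by positivity) (by norm_num)
  have h₂ : (√N * P.card) ^ 2 = N * P.card ^ 2 := by rw [mul_pow, hs]
  have h₃ : 2 * N ≤ m := le_trans (by linarith [mul_nonneg hs' hc]) hlt.le
  nlinarith

theorem UDP_le {N : ℕ} (hN : 1 ≤ N) (p : ℕ) : (UDP N p : ℝ) ≤ √N * p + 2 * N := by
  rw [UDP]
  set A := {k | ∃ G : WGraph (Fin N), G.PosWeights ∧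
    ∃ P : Finset (Fin N × Fin N), P.card = p ∧ (∀ q ∈ P, G.Reachable q.1 q.2) ∧
      minPresU N G P = k} with hA
  rcases A.eq_empty_or_nonempty with h | h
  · rw [h]
    simp only [csSup_empty, bot_eq_zero', Nat.cast_zero]
    positivity
  · have hb : ∀ k ∈ A, (k : ℝ) ≤ √N * p + 2 * N := by
      rintro k ⟨G, hG, P, rfl, hP, rfl⟩
      exact minPresU_le hN hG hP
    exact hb _ (Nat.sSup_mem h ⟨⌊√N * p + 2 * N⌋₊, fun k hk => Nat.le_floor (hb k hk)⟩)

theorem le_UDP {N p : ℕ} (hN : 1 ≤ N) {G : WGraph (Fin N)} (hG : G.PosWeights)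
    {P : Finset (Fin N × Fin N)} (hp : P.card = p) (hP : ∀ q ∈ P, G.Reachable q.1 q.2) :
    minPresU N G P ≤ UDP N p := by
  refine le_csSup ⟨⌊√N * p + 2 * N⌋₊, ?_⟩ ⟨G, hG, P, hp, hP, rfl⟩
  rintro k ⟨G, hG, P, rfl, hP, rfl⟩
  exact Nat.le_floor (minPresU_le hN hG hP)

section OrderedPathSystem

/-- A family of vertex sets `S r`, `r ∈ I`, in a linear order which behave like the vertex sets of
monotone shortest paths for the (partially defined) distance `D`: distances are additive along
each `S r`, and no two of these paths share an edge or can be used to reroute one another. -/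
structure OrderedPathSystem {ι : Type} (N : ℕ) (I : Finset ι) (S : ι → Finset (Fin N)) where
  Reach : Fin N → Fin N → Prop
  D : Fin N → Fin N → ℝ
  ψ : ι → Fin N → ℝ
  reach_self : ∀ a, Reach a a
  D_self : ∀ a, D a a = 0
  D_nonneg : ∀ a b, 0 ≤ D a b
  reach_trans : ∀ a b c, Reach a b → Reach b c → Reach a c
  triangle : ∀ a b c, Reach a b → Reach b c → D a c ≤ D a b + D b c
  reach_of_lt : ∀ r ∈ I, ∀ a ∈ S r, ∀ b ∈ S r, a < b → Reach a b
  D_eq_sub : ∀ r ∈ I, ∀ a ∈ S r, ∀ b ∈ S r, a < b → D a b = ψ r b - ψ r a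
  eq_of_reroute : ∀ r ∈ I, ∀ r' ∈ I, ∀ s ∈ S r, ∀ t ∈ S r, s < t → t ∈ S r' → ∀ u ∈ S r', u < t →
    Reach s u → D s u + D u t = D s t → r = r'

namespace OrderedPathSystem

variable {ι : Type} {N : ℕ} {I : Finset ι} {S : ι → Finset (Fin N)}

/-- `a < b` are consecutive elements of `s`. -/
def Consecutive (s : Finset (Fin N)) (a b : Fin N) : Prop :=
  a ∈ s ∧ b ∈ s ∧ a < b ∧ ∀ c ∈ s, c < b → c ≤ a

theorem exists_consecutive {s : Finset (Fin N)} {a b : Fin N} (ha : a ∈ s) (hb : b ∈ s)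
    (hab : a < b) : ∃ c, a ≤ c ∧ Consecutive s c b := by
  have hne : (s.filter (· < b)).Nonempty := ⟨a, Finset.mem_filter.2 ⟨ha, hab⟩⟩
  have hmem := Finset.mem_filter.1 (Finset.max'_mem _ hne)
  exact ⟨_, Finset.le_max' _ _ (Finset.mem_filter.2 ⟨ha, hab⟩), hmem.1, hb, hmem.2,
    fun c hc hcb => Finset.le_max' _ _ (Finset.mem_filter.2 ⟨hc, hcb⟩)⟩

open Classical in
/-- The undirected edges joining consecutive elements of the sets of the system. -/
noncomputable def edges (I : Finset ι) (S : ι → Finset (Fin N)) : Finset (Sym2 (Fin N)) :=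
  Finset.univ.filter fun e => ∃ r ∈ I, ∃ a b, Consecutive (S r) a b ∧ e = s(a, b)

/-- A penalty exceeding all distances. -/
noncomputable def penalty (T : OrderedPathSystem N I S) : ℝ :=
  1 + ∑ a, ∑ b, T.D a b

/-- The undirected graph of the system: a penalty proportional to the length of an edge in the
linear order forces shortest paths to be monotone. -/
noncomputable def graph (T : OrderedPathSystem N I S) : WGraph (Fin N) where
  Edge := edges I S
  w e := T.D e.inf e.sup + T.penalty * ((e.sup : ℕ) - (e.inf : ℕ) : ℝ)

variable (T : OrderedPathSystem N I S)

theorem mem_edges {a b : Fin N} (hab : a < b) :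
    s(a, b) ∈ edges I S ↔ ∃ r ∈ I, Consecutive (S r) a b := by
  simp only [edges, Finset.mem_filter, Finset.mem_univ, true_and]
  constructor
  · rintro ⟨r, hr, c, d, hcd, h⟩
    rcases Sym2.eq_iff.1 h with ⟨rfl, rfl⟩ | ⟨rfl, rfl⟩
    · exact ⟨r, hr, hcd⟩
    · exact absurd hcd.2.2.1 (not_lt.2 hab.le)
  · rintro ⟨r, hr, h⟩
    exact ⟨r, hr, a, b, h, rfl⟩

theorem D_lt_penalty (a b : Fin N) : T.D a b < T.penalty := by
  have h₁ : T.D a b ≤ ∑ b, T.D a b :=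
    Finset.single_le_sum (f := fun b => T.D a b) (fun c _ => T.D_nonneg a c) (Finset.mem_univ b)
  have h₂ : ∑ b, T.D a b ≤ ∑ a, ∑ b, T.D a b :=
    Finset.single_le_sum (f := fun a => ∑ b, T.D a b)
      (fun c _ => Finset.sum_nonneg fun d _ => T.D_nonneg c d) (Finset.mem_univ a)
  rw [penalty]
  linarith

theorem penalty_pos (a : Fin N) : 0 < T.penalty :=
  (T.D_nonneg a a).trans_lt (T.D_lt_penalty a a)

theorem graph_w {a b : Fin N} (hab : a < b) :
    T.graph.w s(a, b) = T.D a b + T.penalty * ((b : ℕ) - (a : ℕ) : ℝ) := by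
  simp [graph, hab.le]

theorem lt_or_gt_of_mem_edges {a b : Fin N} (h : s(a, b) ∈ edges I S) : a < b ∨ b < a := by
  simp only [edges, Finset.mem_filter, Finset.mem_univ, true_and] at h
  obtain ⟨r, -, c, d, hcd, h⟩ := h
  rcases Sym2.eq_iff.1 h with ⟨rfl, rfl⟩ | ⟨rfl, rfl⟩
  · exact .inl hcd.2.2.1
  · exact .inr hcd.2.2.1

theorem posWeights_graph : T.graph.PosWeights := by
  intro e he
  simp only [graph, edges, Finset.mem_filter, Finset.mem_univ, true_and] at he
  obtain ⟨r, -, a, b, hab, rfl⟩ := he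
  rw [T.graph_w hab.2.2.1]
  have hlt : ((a : ℕ) : ℝ) < (b : ℕ) := by exact_mod_cast hab.2.2.1
  exact add_pos_of_nonneg_of_pos (T.D_nonneg a b) (mul_pos (T.penalty_pos a) (by linarith))

theorem monotone_or_penalty_le {a b : Fin N} {L : List (Fin N × Fin N)}
    (h : DartPath (EdgeRel edgeOf (edges I S)) a b L) :
    T.penalty * ((b : ℕ) - (a : ℕ) : ℝ) ≤ dartWeight (T.graph.w ∘ edgeOf) L ∧
      ((∀ e ∈ L, e.1 < e.2) ∨
        T.penalty * ((b : ℕ) - (a : ℕ) : ℝ) + T.penalty ≤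
          dartWeight (T.graph.w ∘ edgeOf) L) := by
  induction h with
  | nil => simp
  | @cons a c b L h₁ _ ih =>
    have hM := T.penalty_pos a
    simp only [dartWeight_cons, Function.comp, edgeOf] at ih ⊢
    rcases lt_or_gt_of_mem_edges h₁ with hac | hca
    · have hw := T.graph_w hac
      have hD := T.D_nonneg a c
      refine ⟨by linarith [ih.1], ih.2.imp (fun h e he => ?_) fun h => by linarith⟩
      rcases List.mem_cons.1 he with rfl | he
      · exact hac
      · exact h e he
    · have hw := T.graph_w hca
      rw [Sym2.eq_swap] at hw
      have hD := T.D_nonneg c a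
      have hlt : ((c : ℕ) : ℝ) + 1 ≤ (a : ℕ) := by exact_mod_cast hca
      have := mul_le_mul_of_nonneg_left hlt hM.le
      exact ⟨by nlinarith [ih.1], .inr (by nlinarith [ih.1])⟩

theorem le_weight_of_monotone {a b : Fin N} {L : List (Fin N × Fin N)}
    (h : DartPath (EdgeRel edgeOf (edges I S)) a b L) (hL : ∀ e ∈ L, e.1 < e.2) :
    a ≤ b ∧ T.Reach a b ∧
      T.D a b + T.penalty * ((b : ℕ) - (a : ℕ) : ℝ) ≤ dartWeight (T.graph.w ∘ edgeOf) L := by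
  induction h with
  | nil a => simp [T.reach_self, T.D_self]
  | @cons a c b L h₁ _ ih =>
    have hac : a < c := hL _ List.mem_cons_self
    obtain ⟨hcb, hreach, hle⟩ := ih fun e he => hL e (List.mem_cons_of_mem _ he)
    obtain ⟨r, hr, hcons⟩ := (mem_edges hac).1 h₁
    have hac' := T.reach_of_lt r hr a hcons.1 c hcons.2.1 hac
    refine ⟨hac.le.trans hcb, T.reach_trans _ _ _ hac' hreach, ?_⟩
    have := T.triangle _ _ _ hac' hreach
    have := T.graph_w hac
    simp only [dartWeight_cons, Function.comp, edgeOf] at hle ⊢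
    linarith

/-- A monotone shortest path joining two vertices of `S r` runs through all vertices of `S r`
in between. -/
theorem mem_of_weight_le {r : ι} (hr : r ∈ I) {a : Fin N} (ha : a ∈ S r)
    {L : List (Fin N × Fin N)} :
    ∀ {b : Fin N}, b ∈ S r → DartPath (EdgeRel edgeOf (edges I S)) a b L →
      (∀ e ∈ L, e.1 < e.2) →
      dartWeight (T.graph.w ∘ edgeOf) L ≤ T.D a b + T.penalty * ((b : ℕ) - (a : ℕ) : ℝ) →
      ∀ {c d : Fin N}, Consecutive (S r) c d → a ≤ c → d ≤ b → (c, d) ∈ L := by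
  induction L using List.reverseRecOn with
  | nil =>
    intro b hb h _ _ c d hcd hac hdb
    obtain rfl := h.eq_of_nil
    exact absurd (hac.trans_lt hcd.2.2.1) (not_lt.2 hdb)
  | append_singleton L e ih =>
    intro b hb h hL hle c d hcd hac hdb
    obtain ⟨hpath, he, rfl⟩ := DartPath.concat_iff.1 h
    obtain ⟨u, b⟩ := e
    have hub : u < b := hL (u, b) (by simp)
    have hL' : ∀ e ∈ L, e.1 < e.2 := fun e he => hL e (List.mem_append_left _ he)
    obtain ⟨hau, hreach, hDu⟩ := T.le_weight_of_monotone hpath hL'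
    obtain ⟨r', hr', hub'⟩ := (mem_edges hub).1 he
    have htri := T.triangle _ _ _ hreach (T.reach_of_lt r' hr' u hub'.1 b hub'.2.1 hub)
    have hw := T.graph_w hub
    simp only [dartWeight_append, dartWeight_cons, dartWeight_nil, Function.comp, edgeOf]
      at hle hDu hpath hau hreach htri
    obtain rfl := T.eq_of_reroute r hr r' hr' a ha b hb (hau.trans_lt hub) hub'.2.1 u hub'.1 hub
      hreach (by linarith)
    rcases hdb.eq_or_lt with rfl | hlt
    · obtain rfl : c = u := le_antisymm (hub'.2.2.2 c hcd.1 hcd.2.2.1)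
        (hcd.2.2.2 u hub'.1 hub)
      simp
    · exact List.mem_append_left _
        (ih hub'.1 hpath hL' (by linarith) hcd hac (hub'.2.2.2 d hcd.2.1 hlt))

theorem exists_path {r : ι} (hr : r ∈ I) {a : Fin N} (ha : a ∈ S r) (b : Fin N) (hb : b ∈ S r)
    (hab : a ≤ b) : ∃ L, DartPath (EdgeRel edgeOf (edges I S)) a b L ∧
      dartWeight (T.graph.w ∘ edgeOf) L = T.D a b + T.penalty * ((b : ℕ) - (a : ℕ) : ℝ) := by
  induction b using WellFoundedLT.induction with
  | _ b ih =>
    rcases hab.eq_or_lt with rfl | hlt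
    · exact ⟨[], .nil a, by simp [T.D_self]⟩
    · obtain ⟨c, hac, hcb⟩ := exists_consecutive ha hb hlt
      obtain ⟨L, hL, hw⟩ := ih c hcb.2.2.1 hcb.1 hac
      refine ⟨L ++ [(c, b)], hL.append (.single ((mem_edges hcb.2.2.1).2 ⟨r, hr, hcb⟩)), ?_⟩
      have hadd : T.D a c + T.D c b = T.D a b := by
        rcases hac.eq_or_lt with rfl | hac
        · rw [T.D_self, zero_add]
        · rw [T.D_eq_sub r hr a ha c hcb.1 hac, T.D_eq_sub r hr c hcb.1 b hb hcb.2.2.1,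
            T.D_eq_sub r hr a ha b hb hlt]
          ring
      have hw' := T.graph_w hcb.2.2.1
      simp only [dartWeight_append, dartWeight_cons, dartWeight_nil, hw]
      simp only [Function.comp, edgeOf, hw', ← hadd]
      ring

include T in
/-- The edges joining consecutive elements of the different sets are all different. -/
theorem sum_card_le : ∑ r ∈ I, (S r).card ≤ (edges I S).card + I.card := by
  classical
  set B : ι → Finset (Fin N) := fun r => (S r).filter fun b => ∃ a, Consecutive (S r) a b with hB
  have hcard : ∀ r, (S r).card ≤ (B r).card + 1 := by
    intro r
    rw [← Finset.card_filter_add_card_filter_not (s := S r) fun b => ∃ a, Consecutive (S r) a b]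
    refine Nat.add_le_add_left (Finset.card_le_one.2 fun x hx y hy => ?_) _
    simp only [Finset.mem_filter, not_exists] at hx hy
    by_contra hne
    rcases lt_or_gt_of_ne hne with h | h
    · obtain ⟨c, -, hc⟩ := exists_consecutive hx.1 hy.1 h
      exact hy.2 c hc
    · obtain ⟨c, -, hc⟩ := exists_consecutive hy.1 hx.1 h
      exact hx.2 c hc
  have hpred : ∀ x : Σ _ : ι, Fin N, ∃ a, x.2 ∈ B x.1 → Consecutive (S x.1) a x.2 := by
    intro x
    by_cases hx : x.2 ∈ B x.1
    · obtain ⟨a, ha⟩ := (Finset.mem_filter.1 hx).2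
      exact ⟨a, fun _ => ha⟩
    · exact ⟨x.2, fun h => absurd h hx⟩
  choose pred hpred using hpred
  have hsum : ∑ r ∈ I, (B r).card ≤ (edges I S).card := by
    rw [← Finset.card_sigma]
    refine Finset.card_le_card_of_injOn (fun x => s(pred x, x.2)) ?_ ?_
    · intro x hx
      obtain ⟨hr, hb⟩ := Finset.mem_sigma.1 hx
      have hc := hpred x hb
      exact (mem_edges hc.2.2.1).2 ⟨x.1, hr, hc⟩
    · intro x hx y hy hxy
      obtain ⟨hr, hb⟩ := Finset.mem_sigma.1 hx
      obtain ⟨hr', hb'⟩ := Finset.mem_sigma.1 hy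
      have hc := hpred x hb
      have hc' := hpred y hb'
      rcases Sym2.eq_iff.1 hxy with ⟨h₁, h₂⟩ | ⟨h₁, h₂⟩
      · rw [← h₁, ← h₂] at hc'
        have := T.eq_of_reroute x.1 hr y.1 hr' _ hc.1 _ hc.2.1 hc.2.2.1 hc'.2.1 _ hc'.1 hc.2.2.1
          (T.reach_self _) (by rw [T.D_self, zero_add])
        exact Sigma.ext this (heq_of_eq h₂)
      · have h₃ := hc.2.2.1
        have h₄ := hc'.2.2.1
        rw [h₁, h₂] at h₃
        exact absurd h₃ (not_lt.2 h₄.le)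
  calc ∑ r ∈ I, (S r).card ≤ ∑ r ∈ I, ((B r).card + 1) := Finset.sum_le_sum fun r _ => hcard r
    _ = ∑ r ∈ I, (B r).card + I.card := by rw [Finset.sum_add_distrib]; simp
    _ ≤ _ := Nat.add_le_add_right hsum _

theorem edges_subset_of_isPreserver {P : Finset (Fin N × Fin N)} {F : Finset (Sym2 (Fin N))}
    (hF : IsPreserver edgeOf T.graph.w (edges I S) F P)
    (hP : ∀ r ∈ I, ∃ q ∈ P, q.1 ∈ S r ∧ q.2 ∈ S r ∧ ∀ c ∈ S r, q.1 ≤ c ∧ c ≤ q.2) :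
    edges I S ⊆ F := by
  intro e he
  simp only [edges, Finset.mem_filter, Finset.mem_univ, true_and] at he
  obtain ⟨r, hr, c, d, hcd, rfl⟩ := he
  obtain ⟨⟨a, b⟩, hq, ha, hb, hab⟩ := hP r hr
  have hposE : PosOn (EdgeRel edgeOf (edges I S)) (T.graph.w ∘ edgeOf) :=
    posOn_edgeRel T.posWeights_graph (Finset.Subset.refl (edges I S))
  have hposF : PosOn (EdgeRel edgeOf F) (T.graph.w ∘ edgeOf) :=
    posOn_edgeRel T.posWeights_graph hF.1
  obtain ⟨⟨L₀, hL₀⟩, hdist⟩ := hF.2 _ hq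
  obtain ⟨L, hL⟩ := hL₀.exists_isOptPath hposF
  obtain ⟨L₁, hL₁, hw₁⟩ := T.exists_path hr ha b hb (hab a ha).2
  have hle : dartWeight (T.graph.w ∘ edgeOf) L ≤
      T.D a b + T.penalty * ((b : ℕ) - (a : ℕ) : ℝ) := by
    rw [hL.weight_eq hposF, hdist, ← hw₁]
    exact pathDist_le hposE hL₁
  have hLE := hL.1.edgeRel_mono hF.1
  have hmono : ∀ e ∈ L, e.1 < e.2 := by
    refine (T.monotone_or_penalty_le hLE).2.resolve_right fun h => ?_
    have := T.D_lt_penalty a b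
    linarith
  exact hL.1.rel_of_mem
    (T.mem_of_weight_le hr ha hb hLE hmono hle hcd (hab c hcd.1).1 (hab d hcd.2.1).2)

include T in
theorem sum_card_le_UDP (hN : 1 ≤ N) {p : ℕ} (hI : I.card ≤ p) (hp : p ≤ N)
    (hS : ∀ r ∈ I, (S r).Nonempty) :
    ∑ r ∈ I, (S r).card ≤ UDP N p + I.card := by
  classical
  have : NeZero N := ⟨by omega⟩
  have hends : ∀ r ∈ I, ∃ q : Fin N × Fin N,
      q.1 ∈ S r ∧ q.2 ∈ S r ∧ ∀ c ∈ S r, q.1 ≤ c ∧ c ≤ q.2 := fun r hr =>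
    ⟨((S r).min' (hS r hr), (S r).max' (hS r hr)), Finset.min'_mem _ (hS r hr),
      Finset.max'_mem _ (hS r hr), fun c hc => ⟨Finset.min'_le _ _ hc, Finset.le_max' _ _ hc⟩⟩
  choose! q hq using hends
  have hreach : ∀ x : Fin N × Fin N, T.graph.Reachable x.1 x.2 ↔
      ∃ L, DartPath (EdgeRel edgeOf (edges I S)) x.1 x.2 L := fun x =>
    WGraph.exists_isWalkOn_iff _ _ _
  obtain ⟨P, hqP, hP, hcard⟩ := Finset.exists_subsuperset_card_eq
    (s := I.image q) (t := Finset.univ.filter fun x => T.graph.Reachable x.1 x.2) (n := p)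
    (by
      intro x hx
      obtain ⟨r, hr, rfl⟩ := Finset.mem_image.1 hx
      obtain ⟨ha, hb, hab⟩ := hq r hr
      obtain ⟨L, hL, -⟩ := T.exists_path hr ha _ hb (hab _ ha).2
      exact Finset.mem_filter.2 ⟨Finset.mem_univ _, (hreach _).2 ⟨L, hL⟩⟩)
    (Finset.card_image_le.trans hI)
    (by
      calc p ≤ (Finset.univ : Finset (Fin N)).card := by simpa using hp
        _ ≤ _ := Finset.card_le_card_of_injOn (fun a => (a, a))
          (fun a _ => Finset.mem_coe.2 (Finset.mem_filter.2
            ⟨Finset.mem_univ _, (hreach _).2 ⟨[], .nil a⟩⟩))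
          fun a _ b _ h => congrArg Prod.fst h)
  have hP' : ∀ x ∈ P, T.graph.Reachable x.1 x.2 := fun x hx => (Finset.mem_filter.1 (hP hx)).2
  refine T.sum_card_le.trans (Nat.add_le_add_right ?_ _)
  refine le_trans ?_ (le_UDP hN T.posWeights_graph hcard hP')
  refine le_csInf ⟨_, _, (T.graph.isExactPreserver_iff _ _).2
    (isPreserver_self fun x hx => (hreach x).1 (hP' x hx)), rfl⟩ ?_
  rintro k ⟨F, hF, rfl⟩
  exact Finset.card_le_card (T.edges_subset_of_isPreserver ((T.graph.isExactPreserver_iff _ _).1 hF)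
    fun r hr => ⟨q r, hqP (Finset.mem_image_of_mem q hr), hq r hr⟩)

end OrderedPathSystem

theorem pred_le_UDP {N p : ℕ} (hp : 1 ≤ p) (hpN : p ≤ N) : N ≤ UDP N p + 1 := by
  let T : OrderedPathSystem N ({()} : Finset Unit) fun _ => Finset.univ :=
    { Reach := fun _ _ => True
      D := fun _ _ => 0
      ψ := fun _ _ => 0
      reach_self := by simp
      D_self := by simp
      D_nonneg := by simp
      reach_trans := by simp
      triangle := by simp
      reach_of_lt := by simp
      D_eq_sub := by simp
      eq_of_reroute := by simp }
  have := T.sum_card_le_UDP (hp.trans hpN) (p := p) (by simpa using hp) hpN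
    fun _ _ => ⟨⟨0, by omega⟩, Finset.mem_univ _⟩
  simpa using this

end OrderedPathSystem

section Directed

theorem IsOptPath.pathDist_eq_add {V : Type} {R : V → V → Prop} {w : V × V → ℝ} {s t : V}
    {L : List (V × V)} {e f : V × V} (hpos : PosOn R w) (h : IsOptPath R w s t L)
    (hef : [e, f].Sublist L) :
    pathDist R w s f.2 = pathDist R w s e.2 + pathDist R w e.2 f.2 := by
  obtain ⟨A, B, C, rfl, -, hA, hB, hC⟩ := h.exists_between hef
  have h₁ : IsOptPath R w s e.2 A :=
    IsOptPath.middle (A := []) (M := A) (C := (B ++ [f]) ++ C) (by simpa using h) (.nil s) hA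
      (hB.1.append hC)
  have h₂ : IsOptPath R w s f.2 (A ++ (B ++ [f])) :=
    IsOptPath.middle (A := []) (by simpa using h) (.nil s) (hA.append hB.1) hC
  rw [← h₁.weight_eq hpos, ← h₂.weight_eq hpos, ← hB.weight_eq hpos, dartWeight_append]

namespace CriticalSystem

variable {V : Type} {ω : V × V → ℝ} {F P : Finset (V × V)}

theorem dart_eq (S : CriticalSystem id ω F P) {k : V × V} (hk : k ∈ F) : S.dart k = k :=
  S.map_dart k hk

theorem mem_path_owner (S : CriticalSystem id ω F P) {k : V × V} (hk : k ∈ F) :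
    k ∈ S.path (S.owner k) := by
  simpa only [S.dart_eq hk] using S.dart_mem k hk

theorem posOn (hω : ∀ k ∈ F, 0 < ω k) : PosOn (EdgeRel id F) ω :=
  posOn_edgeRel (κ := id) hω (Finset.Subset.refl F)

theorem eq_of_mem_path (S : CriticalSystem id ω F P) (hω : ∀ k ∈ F, 0 < ω k) {k l : V × V}
    (hl : l ∈ F) (hk : k ∈ S.path (S.owner l)) (hkl : k.2 = l.2) : k = l :=
  (S.isOptPath_owner hl).eq_of_snd_eq (posOn hω) hk (S.mem_path_owner hl) hkl

/-- Every optimal path joining the heads of two darts of the path of `r` contains the second of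
these darts, provided that dart is owned by `r`. -/
theorem mem_of_sublist (S : CriticalSystem id ω F P) (hω : ∀ k ∈ F, 0 < ω k) {e k : V × V}
    {M : List (V × V)} (hk : k ∈ F) (hs : [e, k].Sublist (S.path (S.owner k)))
    (hM : IsOptPath (EdgeRel id F) ω e.2 k.2 M) : k ∈ M := by
  have := (S.isOptPath_owner hk).mem_of_forall_mem (posOn hω) (κ := id) (fun _ _ h => .inl h)
    (fun L hL => S.critical k hk L hL) hs hM
  simpa using this

variable {N : ℕ}

open Classical in
/-- The indices `a ∈ A` for which `r` owns a dart with the same head as `z a`. -/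
noncomputable def hits (S : CriticalSystem id ω F P) (z : Fin N → V × V) (A : Finset (Fin N))
    (r : V × V) : Finset (Fin N) :=
  A.filter fun a => ∃ k ∈ F, S.owner k = r ∧ k.2 = (z a).2

theorem mem_hits {S : CriticalSystem id ω F P} {z : Fin N → V × V} {A : Finset (Fin N)}
    {r : V × V} {a : Fin N} :
    a ∈ S.hits z A r ↔ a ∈ A ∧ ∃ k ∈ F, S.owner k = r ∧ k.2 = (z a).2 := by
  classical
  exact Finset.mem_filter

section Hits

variable {S : CriticalSystem id ω F P} {z : Fin N → V × V} {A : Finset (Fin N)} {q : V × V}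

/-- A path sharing two vertices with the path of `q` visits them in the opposite order. -/
theorem sublist_of_hits (hω : ∀ k ∈ F, 0 < ω k) (hz : ∀ a ∈ A, z a ∈ F ∧ S.owner (z a) = q)
    (hsub : ∀ a ∈ A, ∀ b ∈ A, a < b → [z b, z a].Sublist (S.path q)) {a b : Fin N} (ha : a ∈ A)
    (hb : b ∈ A) (hab : a < b) {k l : V × V} (hk : k ∈ F) (hl : l ∈ F)
    (ho : S.owner k = S.owner l) (hq : S.owner k ≠ q) (hka : k.2 = (z a).2)
    (hlb : l.2 = (z b).2) : [k, l].Sublist (S.path (S.owner k)) := by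
  have hza := hz a ha
  have hopt := S.isOptPath_owner hza.1
  rw [hza.2] at hopt
  have hs := hsub a ha b hb hab
  have hne : k ≠ l := by
    rintro rfl
    exact List.nodup_map_iff_forall_sublist.1 (hopt.nodup_map_snd (posOn hω)) _ _ hs
      (hlb.symm.trans hka)
  refine (List.pair_sublist_or_of_mem (S.mem_path_owner hk) (ho ▸ S.mem_path_owner hl)
    hne).resolve_right fun hlk => hq ?_
  obtain ⟨B₁, B₂, B₃, hB, -, -, hM, -⟩ := hopt.exists_between hs
  have hkM := S.mem_of_sublist hω hk hlk (hlb ▸ hka ▸ hM)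
  have hkq : k ∈ S.path (S.owner (z a)) := by
    rw [hza.2, hB]
    exact List.mem_append_left _ (List.mem_append_right _ hkM)
  rw [S.eq_of_mem_path hω hza.1 hkq hka, hza.2]

/-- The other demand pairs induce an ordered path system on a part of the path of `q`. -/
noncomputable def orderedPathSystem [Finite V] (hω : ∀ k ∈ F, 0 < ω k)
    (hz : ∀ a ∈ A, z a ∈ F ∧ S.owner (z a) = q)
    (hsub : ∀ a ∈ A, ∀ b ∈ A, a < b → [z b, z a].Sublist (S.path q)) (I : Finset (V × V))
    (hI : q ∉ I) : OrderedPathSystem N I (S.hits z A) where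
  Reach a b := ∃ L, DartPath (EdgeRel id F) (z a).2 (z b).2 L
  D a b := pathDist (EdgeRel id F) ω (z a).2 (z b).2
  ψ r a := pathDist (EdgeRel id F) ω r.1 (z a).2
  reach_self a := ⟨[], .nil _⟩
  D_self a := pathDist_self (posOn hω)
  D_nonneg a b := pathDist_nonneg (posOn hω)
  reach_trans := fun a b c ⟨L, hL⟩ ⟨M, hM⟩ => ⟨L ++ M, hL.append hM⟩
  triangle := fun a b c ⟨L, hL⟩ ⟨M, hM⟩ => pathDist_triangle (posOn hω) hL hM
  reach_of_lt := by
    intro r hr a ha b hb hab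
    obtain ⟨ha', k, hk, rfl, hka⟩ := mem_hits.1 ha
    obtain ⟨hb', l, hl, ho, hlb⟩ := mem_hits.1 hb
    have hs := sublist_of_hits hω hz hsub ha' hb' hab hk hl ho.symm (fun h => hI (h ▸ hr)) hka hlb
    obtain ⟨_, B, _, -, -, -, hM, -⟩ := (S.isOptPath_owner hk).exists_between hs
    exact ⟨_, hka ▸ hlb ▸ hM.1⟩
  D_eq_sub := by
    intro r hr a ha b hb hab
    obtain ⟨ha', k, hk, rfl, hka⟩ := mem_hits.1 ha
    obtain ⟨hb', l, hl, ho, hlb⟩ := mem_hits.1 hb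
    have hs := sublist_of_hits hω hz hsub ha' hb' hab hk hl ho.symm (fun h => hI (h ▸ hr)) hka hlb
    have := IsOptPath.pathDist_eq_add (posOn hω) (S.isOptPath_owner hk) hs
    rw [← hka, ← hlb]
    exact eq_sub_of_add_eq' this.symm
  eq_of_reroute := by
    intro r hr r' hr' s hs t ht hst ht' u hu hut ⟨M₁, hM₁⟩ hD
    obtain ⟨hs', k, hk, rfl, hks⟩ := mem_hits.1 hs
    obtain ⟨ht'', l, hl, ho, hlt⟩ := mem_hits.1 ht
    obtain ⟨hu', k', hk', rfl, hku⟩ := mem_hits.1 hu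
    obtain ⟨-, l', hl', ho', hlt'⟩ := mem_hits.1 ht'
    have hpos := posOn hω
    have h₁ := sublist_of_hits hω hz hsub hs' ht'' hst hk hl ho.symm (fun h => hI (h ▸ hr)) hks hlt
    have h₂ := sublist_of_hits hω hz hsub hu' ht'' hut hk' hl' ho'.symm (fun h => hI (h ▸ hr'))
      hku hlt'
    obtain ⟨M, hM⟩ := hM₁.exists_isOptPath hpos
    obtain ⟨_, B, _, -, -, -, hB, -⟩ := (S.isOptPath_owner hk').exists_between h₂
    have hpath : DartPath (EdgeRel id F) k.2 l.2 (M ++ (B ++ [l'])) := by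
      rw [hks, hlt]
      exact hM.1.append (hku ▸ hlt' ▸ hB.1)
    have hw : dartWeight ω (M ++ (B ++ [l'])) ≤ pathDist (EdgeRel id F) ω k.2 l.2 := by
      have hw₂ : dartWeight ω (B ++ [l']) = _ := hB.weight_eq hpos
      rw [dartWeight_append, hM.weight_eq hpos, hw₂, hks, hlt, ← hD, hku, hlt']
    have hopt := hpath.isOptPath hpos hw
    have hll : l = l' := hopt.eq_of_snd_eq hpos (S.mem_of_sublist hω hl (ho ▸ h₁) hopt) (by simp)
      (hlt.trans hlt'.symm)
    rw [← ho, hll, ho']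

end Hits

open Classical in
/-- The number of edges of `F` entering `v`. -/
noncomputable def inDegree (F : Finset (V × V)) (v : V) : ℕ := (F.filter fun k => k.2 = v).card

theorem sum_inDegree_le_sum_hits (S : CriticalSystem id ω F P) (hω : ∀ k ∈ F, 0 < ω k)
    (z : Fin N → V × V) (A : Finset (Fin N)) :
    ∑ a ∈ A, inDegree F (z a).2 ≤ ∑ r ∈ P, (S.hits z A r).card := by
  classical
  have h : ∀ r, S.hits z A r = Finset.bipartiteBelow (fun a r => a ∈ S.hits z A r) A r := by
    intro r
    ext a
    simp only [Finset.mem_bipartiteBelow]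
    exact ⟨fun h => ⟨(mem_hits.1 h).1, h⟩, fun h => h.2⟩
  rw [Finset.sum_congr rfl fun r _ => congrArg Finset.card (h r),
    ← Finset.sum_card_bipartiteAbove_eq_sum_card_bipartiteBelow]
  refine Finset.sum_le_sum fun a ha => ?_
  refine Finset.card_le_card_of_injOn S.owner ?_ ?_
  · intro k hk
    obtain ⟨hk, hka⟩ := Finset.mem_filter.1 hk
    exact Finset.mem_coe.2 ((Finset.mem_bipartiteAbove _).2
      ⟨S.owner_mem k hk, mem_hits.2 ⟨ha, k, hk, rfl, hka⟩⟩)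
  · intro k hk l hl ho
    obtain ⟨hk, hka⟩ := Finset.mem_filter.1 hk
    obtain ⟨hl, hla⟩ := Finset.mem_filter.1 hl
    exact S.eq_of_owner_eq hω hk hl ho (by rw [S.dart_eq hk, S.dart_eq hl, hka, hla])

theorem sum_inDegree_le_UDP [Finite V] (S : CriticalSystem id ω F P) (hω : ∀ k ∈ F, 0 < ω k)
    (hN : 1 ≤ N) (hP : P.card ≤ N) {q : V × V} (hq : q ∈ P) {z : Fin N → V × V}
    {A : Finset (Fin N)} (hz : ∀ a ∈ A, z a ∈ F ∧ S.owner (z a) = q)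
    (hsub : ∀ a ∈ A, ∀ b ∈ A, a < b → [z b, z a].Sublist (S.path q)) :
    ∑ a ∈ A, inDegree F (z a).2 ≤ UDP N P.card + P.card + N := by
  classical
  set I := (P.erase q).filter fun r => (S.hits z A r).Nonempty with hI
  have hIP : I.card ≤ P.card :=
    Finset.card_le_card ((Finset.filter_subset _ _).trans (Finset.erase_subset _ _))
  have hsum : ∑ r ∈ P.erase q, (S.hits z A r).card = ∑ r ∈ I, (S.hits z A r).card := by
    rw [hI, Finset.sum_filter_of_ne]
    intro r _ hr
    exact Finset.card_pos.1 (Nat.pos_of_ne_zero hr)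
  have hqA : (S.hits z A q).card ≤ N :=
    (Finset.card_le_univ _).trans (Fintype.card_fin N).le
  have hT := (orderedPathSystem hω hz hsub I (by simp [hI])).sum_card_le_UDP hN hIP hP
    fun r hr => (Finset.mem_filter.1 hr).2
  have h := S.sum_inDegree_le_sum_hits hω z A
  rw [← Finset.add_sum_erase P _ hq, hsum] at h
  omega

theorem sum_map_inDegree_le_UDP [Finite V] (S : CriticalSystem id ω F P)
    (hω : ∀ k ∈ F, 0 < ω k) (hN : 1 ≤ N) (hP : P.card ≤ N) {q : V × V} (hq : q ∈ P)
    {Z : List (V × V)} (hZ : ∀ e ∈ Z, e ∈ F ∧ S.owner e = q) (hsub : Z.Sublist (S.path q))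
    (hlen : Z.length ≤ N) :
    (Z.map fun e => inDegree F e.2).sum ≤ UDP N P.card + P.card + N := by
  classical
  set z : ℕ → V × V := fun i => Z.reverse.getD i q with hz
  have hz' : ∀ i (hi : i < Z.reverse.length), z i = Z.reverse[i] := fun i hi => by
    simp only [hz, List.getD_eq_getElem _ _ hi]
  set A := (Finset.univ : Finset (Fin N)).filter fun a : Fin N => (a : ℕ) < Z.reverse.length with hA
  have hA' : ∀ a ∈ A, (a : ℕ) < Z.reverse.length := fun a ha => (Finset.mem_filter.1 ha).2
  have key := S.sum_inDegree_le_UDP hω hN hP hq (z := fun a => z a) (A := A) (fun a ha => by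
      rw [hz' a (hA' a ha)]
      exact hZ _ (List.mem_reverse.1 (List.getElem_mem _))) (fun a ha b hb hab => by
      rw [hz' a (hA' a ha), hz' b (hA' b hb)]
      have hp : Z.reverse.Pairwise fun x y => [x, y].Sublist Z.reverse :=
        List.pairwise_iff_forall_sublist.2 fun h => h
      have := (List.pairwise_iff_getElem.1 hp a b (hA' a ha) (hA' b hb) hab).reverse
      rw [List.reverse_reverse] at this
      exact List.Sublist.trans (by simpa using this) hsub)
  refine le_trans (le_of_eq ?_) key
  calc (Z.map fun e => inDegree F e.2).sum
      = (Z.reverse.map fun e => inDegree F e.2).sum := by rw [List.map_reverse, List.sum_reverse]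
    _ = ∑ i : Fin Z.reverse.length, inDegree F (z i).2 := by
        rw [← Fin.sum_univ_fun_getElem]
        exact Finset.sum_congr rfl fun i _ => by rw [hz' i i.2]
    _ = ∑ i ∈ Finset.range Z.reverse.length, inDegree F (z i).2 :=
        Fin.sum_univ_eq_sum_range (fun i => inDegree F (z i).2) _
    _ = ∑ i ∈ Finset.range N, if i < Z.reverse.length then inDegree F (z i).2 else 0 := by
        rw [← Finset.sum_filter]
        refine Finset.sum_congr (Finset.ext fun i => ?_) fun _ _ => rfl
        simp only [Finset.mem_range, Finset.mem_filter, List.length_reverse]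
        omega
    _ = ∑ a ∈ A, inDegree F (z a).2 := by
        rw [hA, Finset.sum_filter, ← Fin.sum_univ_eq_sum_range
          (fun i => if i < Z.reverse.length then inDegree F (z i).2 else 0)]

theorem _root_.List.sum_map_le_of_sublist {α : Type} {f : α → ℝ} (hN : 1 ≤ N) {T : ℝ}
    (hT : 0 ≤ T) (l : List α)
    (h : ∀ Z : List α, Z.Sublist l → Z.length ≤ N → (Z.map f).sum ≤ T) :
    (l.map f).sum ≤ (l.length / N + 1) * T := by
  have hN' : (0 : ℝ) < N := by exact_mod_cast hN
  induction hn : l.length using Nat.strong_induction_on generalizing l with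
  | _ n ih =>
    subst hn
    rcases le_or_gt l.length N with hl | hl
    · exact (h l (List.Sublist.refl l) hl).trans
        (le_mul_of_one_le_left hT (le_add_of_nonneg_left (by positivity)))
    · have h₁ := h _ (List.take_sublist N l) (List.length_take_le N l)
      have h₂ := ih (l.drop N).length (by rw [List.length_drop]; omega) (l.drop N)
        (fun Z hZ => h Z (hZ.trans (List.drop_sublist N l))) rfl
      have h₃ : ((l.drop N).length : ℝ) / N = l.length / N - 1 := by
        rw [List.length_drop, Nat.cast_sub hl.le, sub_div, div_self hN'.ne']
      rw [← List.take_append_drop N l, List.map_append, List.sum_append,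
        List.take_append_drop]
      rw [h₃] at h₂
      linarith

theorem sq_card_directed_le [Fintype V] (S : CriticalSystem id ω F P) (hω : ∀ k ∈ F, 0 < ω k)
    (hN : 1 ≤ N) (hP : P.card ≤ N) :
    (F.card : ℝ) ^ 2 ≤
      Fintype.card V * ((F.card / N + P.card) * (UDP N P.card + P.card + N)) := by
  classical
  set T : ℝ := UDP N P.card + P.card + N with hT
  have hT0 : 0 ≤ T := by positivity
  set Y : V × V → List (V × V) := fun q =>
    (S.path q).filter fun e => e ∈ F ∧ S.owner e = q with hY
  have hYmem : ∀ q, ∀ e ∈ Y q, e ∈ F ∧ S.owner e = q := fun q e he => by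
    simpa using (List.mem_filter.1 he).2
  have hnd : ∀ q ∈ P, (Y q).Nodup := fun q hq =>
    (((S.isOptPath q hq).nodup_map_snd (posOn hω)).of_map _).filter _
  have hYF : ∀ q, (Y q).toFinset = F.filter fun e => S.owner e = q := fun q => by
    ext e
    simp only [List.mem_toFinset, Finset.mem_filter]
    refine ⟨hYmem q e, fun h => List.mem_filter.2 ⟨?_, by simpa using h⟩⟩
    exact h.2 ▸ S.mem_path_owner h.1
  have hlen : ∑ q ∈ P, ((Y q).length : ℝ) = F.card := by
    rw [Finset.card_eq_sum_card_fiberwise (f := S.owner) (t := P) fun k hk => S.owner_mem k hk,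
      Nat.cast_sum]
    refine Finset.sum_congr rfl fun q hq => ?_
    rw [← hYF, List.toFinset_card_of_nodup (hnd q hq)]
  have hsum : ((((F ×ˢ F).filter fun x => x.1.2 = x.2.2).card : ℕ) : ℝ) =
      ∑ q ∈ P, ((Y q).map fun e => (inDegree F e.2 : ℝ)).sum := by
    rw [Finset.card_filter, Finset.sum_product, Nat.cast_sum,
      ← Finset.sum_fiberwise_of_maps_to (g := S.owner) (t := P) fun k hk => S.owner_mem k hk]
    refine Finset.sum_congr rfl fun q hq => ?_
    rw [← hYF, List.sum_toFinset _ (hnd q hq)]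
    refine congrArg List.sum (List.map_congr_left fun e _ => ?_)
    rw [inDegree, Finset.card_filter]
    simp only [eq_comm]
  have hq : ∀ q ∈ P, ((Y q).map fun e => (inDegree F e.2 : ℝ)).sum ≤
      ((Y q).length / N + 1) * T := by
    intro q hq
    refine List.sum_map_le_of_sublist hN hT0 _ fun Z hZ hZN => ?_
    have := S.sum_map_inDegree_le_UDP hω hN hP hq (fun e he => hYmem q e (hZ.subset he))
      (hZ.trans List.filter_sublist) hZN
    have h' : (((Z.map fun e => inDegree F e.2).sum : ℕ) : ℝ) ≤ T := by
      rw [hT]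
      exact_mod_cast this
    rw [Nat.cast_list_sum, List.map_map] at h'
    exact h'
  have h₁ : (F.card : ℝ) ^ 2 ≤ Fintype.card V *
      (((F ×ˢ F).filter fun x => x.1.2 = x.2.2).card : ℕ) := by
    exact_mod_cast sq_card_le F Prod.snd
  refine h₁.trans (mul_le_mul_of_nonneg_left ?_ (Nat.cast_nonneg _))
  rw [hsum]
  refine (Finset.sum_le_sum hq).trans (le_of_eq ?_)
  rw [← Finset.sum_mul, Finset.sum_add_distrib, ← Finset.sum_div, hlen]
  simp

end CriticalSystem

theorem exists_minPresD_eq_DDP {n p : ℕ} (h : DDP n p ≠ 0) :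
    ∃ G : WDigraph (Fin n), G.PosWeights ∧ ∃ P : Finset (Fin n × Fin n), P.card = p ∧
      (∀ q ∈ P, G.Reachable q.1 q.2) ∧ minPresD n G P = DDP n p := by
  refine Nat.sSup_mem (s := {k | ∃ G : WDigraph (Fin n), G.PosWeights ∧
    ∃ P : Finset (Fin n × Fin n), P.card = p ∧ (∀ q ∈ P, G.Reachable q.1 q.2) ∧
      minPresD n G P = k}) ?_ ?_
  · by_contra hne
    rw [Set.not_nonempty_iff_eq_empty] at hne
    exact h (by rw [DDP, hne]; simp)
  · by_contra hbdd
    exact h (Nat.sSup_of_not_bddAbove hbdd)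

theorem sq_DDP_le {n N p : ℕ} [NeZero n] (hN : 1 ≤ N) (hp : p ≤ N) :
    (DDP n p : ℝ) ^ 2 ≤ n * ((DDP n p / N + p) * (UDP N p + p + N)) := by
  rcases eq_or_ne (DDP n p) 0 with h | h
  · rw [h, Nat.cast_zero, zero_pow two_ne_zero]
    positivity
  · obtain ⟨G, hG, P, rfl, hP, hm⟩ := exists_minPresD_eq_DDP h
    obtain ⟨F, hF, hcard, ⟨S⟩⟩ := G.exists_criticalSystem hG P hP
    have := S.sq_card_directed_le (fun k hk => hG k (hF hk)) hN hp
    rwa [hcard, hm, Fintype.card_fin] at this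

end Directed

/-- A size `n ≈ N ^ (3 / 2)`. -/
theorem exists_rescaling {N : ℕ} (hN : 1 ≤ N) :
    ∃ n : ℕ, N ≤ n ∧ (n : ℝ) ≤ 2 * N * √N ∧ (N : ℝ) ≤ (n : ℝ) ^ ((2 : ℝ) / 3) ∧
      (n : ℝ) ^ ((2 : ℝ) / 3) ≤ 2 * N := by
  have hN' : (1 : ℝ) ≤ N := by exact_mod_cast hN
  have hs : 1 ≤ √(N : ℝ) := Real.one_le_sqrt.2 hN'
  have hsq : √(N : ℝ) ^ 2 = N := Real.sq_sqrt (by linarith)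
  have hle : N * √(N : ℝ) ≤ ⌈N * √(N : ℝ)⌉₊ := Nat.le_ceil _
  have hNs : (N : ℝ) ≤ N * √(N : ℝ) := le_mul_of_one_le_right (by linarith) hs
  have hlt : (⌈N * √(N : ℝ)⌉₊ : ℝ) ≤ 2 * N * √N := by
    have := Nat.ceil_lt_add_one (show 0 ≤ N * √(N : ℝ) by positivity)
    linarith
  have hcube : ((⌈N * √(N : ℝ)⌉₊ : ℝ) ^ ((2 : ℝ) / 3)) ^ 3 = (⌈N * √(N : ℝ)⌉₊ : ℝ) ^ 2 := by
    rw [← Real.rpow_natCast, ← Real.rpow_mul (Nat.cast_nonneg _), ← Real.rpow_natCast]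
    norm_num
  have hN3 : (N * √(N : ℝ)) ^ 2 = N ^ 3 := by rw [mul_pow, hsq]; ring
  refine ⟨⌈N * √(N : ℝ)⌉₊, by exact_mod_cast hNs.trans hle, hlt, ?_, ?_⟩
  · refine le_of_pow_le_pow_left₀ three_ne_zero (by positivity) ?_
    rw [hcube, ← hN3]
    exact pow_le_pow_left₀ (by positivity) hle 2
  · refine le_of_pow_le_pow_left₀ three_ne_zero (by positivity) ?_
    rw [hcube]
    refine (pow_le_pow_left₀ (by positivity) hlt 2).trans ?_
    rw [mul_assoc, mul_pow, hN3, mul_pow]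
    gcongr <;> norm_num

/-- if consistent tiebreaking is optimal for directed distance preservers for
`p ≤ n^{2/3}`, then it is optimal for undirected distance preservers for `p ≤ n`. -/
theorem undirected_optimal_of_directed_optimal (c₁ c₂ : ℝ) (hc₁ : 0 < c₁) (hc₂ : 0 < c₂)
    (N₀ : ℕ)
    (hDDP : ∀ n : ℕ, N₀ ≤ n → ∀ p : ℕ, 1 ≤ p → (p : ℝ) ≤ (n : ℝ) ^ ((2 : ℝ) / 3) →
      c₁ * ((n : ℝ) ^ ((2 : ℝ) / 3) * (p : ℝ) + (n : ℝ)) ≤ (DDP n p : ℝ) ∧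
      (DDP n p : ℝ) ≤ c₂ * ((n : ℝ) ^ ((2 : ℝ) / 3) * (p : ℝ) + (n : ℝ))) :
    ∃ c₃ c₄ : ℝ, 0 < c₃ ∧ 0 < c₄ ∧ ∃ N₁ : ℕ, ∀ N : ℕ, N₁ ≤ N → ∀ p : ℕ, 1 ≤ p → p ≤ N →
      c₃ * ((N : ℝ) ^ ((1 : ℝ) / 2) * (p : ℝ) + (N : ℝ)) ≤ (UDP N p : ℝ) ∧
      (UDP N p : ℝ) ≤ c₄ * ((N : ℝ) ^ ((1 : ℝ) / 2) * (p : ℝ) + (N : ℝ)) := by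
  have hN₁ : ∀ N, max N₀ 2 ≤ N → N₀ ≤ N ∧ 2 ≤ N := fun N h => max_le_iff.1 h
  set α : ℝ := c₁ ^ 2 / (2 * (4 * c₂ + 1)) with hα
  have hα0 : 0 < α := by positivity
  refine ⟨1 / (5 / α + 4), 2, by positivity, two_pos, max N₀ 2, fun N hN p hp hpN => ?_⟩
  obtain ⟨hN₀, hN2⟩ := hN₁ N hN
  rw [← Real.sqrt_eq_rpow]
  have hs0 : 0 ≤ √(N : ℝ) * p := by positivity
  refine ⟨?_, by linarith [UDP_le (hp.trans hpN) p]⟩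
  have hU : (N : ℝ) ≤ 2 * UDP N p := by
    have := pred_le_UDP hp hpN
    exact_mod_cast (show N ≤ 2 * UDP N p by omega)
  have hN1 : (1 : ℝ) ≤ N := by exact_mod_cast hp.trans hpN
  have hpN' : (p : ℝ) ≤ N := by exact_mod_cast hpN
  have hp' : (1 : ℝ) ≤ p := by exact_mod_cast hp
  rw [one_div_mul_eq_div, div_le_iff₀ (by positivity)]
  rcases le_or_gt (p : ℝ) (√N) with hps | hps
  · have := mul_le_mul_of_nonneg_left hps (Real.sqrt_nonneg (N : ℝ))
    rw [Real.mul_self_sqrt (Nat.cast_nonneg _)] at this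
    have h5 : (0 : ℝ) ≤ UDP N p * (5 / α) := by positivity
    linarith
  obtain ⟨n, hNn, hn₁, hn₂, hn₃⟩ := exists_rescaling (hp.trans hpN)
  have : NeZero n := ⟨by omega⟩
  obtain ⟨hlow, hupp⟩ := hDDP n (hN₀.trans hNn) p hp (hpN'.trans hn₂)
  have key := sq_DDP_le (n := n) (hp.trans hpN) hpN
  have hs1 : 0 < √(N : ℝ) := Real.sqrt_pos.2 (by linarith)
  have hn0 : (0 : ℝ) ≤ n := Nat.cast_nonneg _
  set m : ℝ := (DDP n p : ℝ)
  set U : ℝ := (UDP N p : ℝ)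
  have hm₁ : c₁ * (N * p) ≤ m := by
    refine le_trans (mul_le_mul_of_nonneg_left ?_ hc₁.le) hlow
    nlinarith
  have hm₂ : m ≤ 4 * c₂ * N * p := by
    refine hupp.trans ?_
    have h₁ : (n : ℝ) ^ ((2 : ℝ) / 3) * p ≤ 2 * N * p := by gcongr
    have h₂ : (n : ℝ) ≤ 2 * N * p := hn₁.trans (by gcongr)
    nlinarith
  have hm₃ : m / N + p ≤ (4 * c₂ + 1) * p := by
    have : m / N ≤ 4 * c₂ * p := (div_le_iff₀ (by linarith)).2 (by linarith)
    linarith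
  have hm₄ : (c₁ * (N * p)) ^ 2 ≤ (2 * N * √N) * (((4 * c₂ + 1) * p) * (U + p + N)) := by
    refine (pow_le_pow_left₀ (by positivity) hm₁ 2).trans (key.trans ?_)
    gcongr
  have hm₅ : α * (√N * p) ≤ U + p + N := by
    rw [hα, div_mul_eq_mul_div, div_le_iff₀ (by positivity)]
    refine le_of_mul_le_mul_left ?_ (show (0 : ℝ) < N * √N * p by positivity)
    calc N * √N * p * (c₁ ^ 2 * (√N * p)) = c₁ ^ 2 * N * p ^ 2 * (√N * √N) := by ring
      _ = (c₁ * (N * p)) ^ 2 := by rw [Real.mul_self_sqrt (Nat.cast_nonneg _)]; ring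
      _ ≤ _ := hm₄
      _ = _ := by ring
  have hm₆ : √N * p ≤ U * (5 / α) := by
    rw [mul_div_assoc', le_div_iff₀ hα0]
    linarith
  linarith
end

section
/- For all integers n, p ≥ 1, DADP(n,p) ≤ UDP(n,p); that is, the maximum size of a minimum exact distance preserver over n-vertex weighted directed acyclic graphs with p demand pairs is at most the corresponding maximum over n-vertex weighted undirected graphs with p demand pairs. -/
open Finset

section Walks

variable {V : Type}

theorem WDigraph.walkWeight_cons_cons (G : WDigraph V) (a b : V) (l : List V) :
    G.walkWeight (a :: b :: l) = G.w (a, b) + G.walkWeight (b :: l) := by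
  simp [WDigraph.walkWeight]

theorem WGraph.walkWeight_cons_cons (G : WGraph V) (a b : V) (l : List V) :
    G.walkWeight (a :: b :: l) = G.w s(a, b) + G.walkWeight (b :: l) := by
  simp [WGraph.walkWeight]

theorem isWalkOn_singleton_iff {F : Finset (V × V)} {s t a : V} :
    IsWalkOn F s t [a] ↔ a = s ∧ a = t := by
  simp [IsWalkOn, List.Chain']

theorem isWalkOn_cons_cons_iff {F : Finset (V × V)} {s t a b : V} {l : List V} :
    IsWalkOn F s t (a :: b :: l) ↔ a = s ∧ (a, b) ∈ F ∧ IsWalkOn F b t (b :: l) := by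
  simp only [IsWalkOn, List.Chain', List.isChain_cons_cons, List.head?_cons, List.getLast?_cons_cons,
    Option.some.injEq]
  tauto

theorem WGraph.isWalkOn_singleton_iff {F : Finset (Sym2 V)} {s t a : V} :
    WGraph.IsWalkOn F s t [a] ↔ a = s ∧ a = t := by
  simp [WGraph.IsWalkOn, List.Chain']

theorem WGraph.isWalkOn_cons_cons_iff {F : Finset (Sym2 V)} {s t a b : V} {l : List V} :
    WGraph.IsWalkOn F s t (a :: b :: l) ↔
      a = s ∧ s(a, b) ∈ F ∧ WGraph.IsWalkOn F b t (b :: l) := by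
  simp only [WGraph.IsWalkOn, List.Chain', List.isChain_cons_cons, List.head?_cons,
    List.getLast?_cons_cons, Option.some.injEq]
  tauto

theorem IsWalkOn.mono {F F' : Finset (V × V)} (h : F ⊆ F') {s t : V} {l : List V}
    (hl : IsWalkOn F s t l) : IsWalkOn F' s t l :=
  ⟨hl.1.imp fun _ _ hab => h hab, hl.2⟩

theorem WDigraph.walkWeight_nonneg {G : WDigraph V} (hG : G.PosWeights) {s t : V} {l : List V}
    (hl : IsWalkOn G.Edge s t l) : 0 ≤ G.walkWeight l := by
  induction l generalizing s with
  | nil => simp [WDigraph.walkWeight]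
  | cons a l ih =>
    cases l with
    | nil => simp [WDigraph.walkWeight]
    | cons b l =>
      rw [isWalkOn_cons_cons_iff] at hl
      rw [WDigraph.walkWeight_cons_cons]
      exact add_nonneg (hG _ hl.2.1).le (ih hl.2.2)

theorem WGraph.walkWeight_nonneg {G : WGraph V} (hG : G.PosWeights) {s t : V} {l : List V}
    (hl : WGraph.IsWalkOn G.Edge s t l) : 0 ≤ G.walkWeight l := by
  induction l generalizing s with
  | nil => simp [WGraph.walkWeight]
  | cons a l ih =>
    cases l with
    | nil => simp [WGraph.walkWeight]
    | cons b l =>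
      rw [WGraph.isWalkOn_cons_cons_iff] at hl
      rw [WGraph.walkWeight_cons_cons]
      exact add_nonneg (hG _ hl.2.1).le (ih hl.2.2)

theorem WDigraph.distOn_le {G : WDigraph V} (hG : G.PosWeights) {F : Finset (V × V)}
    (hF : F ⊆ G.Edge) {s t : V} {l : List V} (hl : IsWalkOn F s t l) :
    G.distOn F s t ≤ G.walkWeight l := by
  refine csInf_le ⟨0, ?_⟩ ⟨l, hl, rfl⟩
  rintro _ ⟨l', hl', rfl⟩
  exact walkWeight_nonneg hG (hl'.mono hF)

theorem WGraph.distOn_le {G : WGraph V} (hG : G.PosWeights) {F : Finset (Sym2 V)}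
    (hF : F ⊆ G.Edge) {s t : V} {l : List V} (hl : WGraph.IsWalkOn F s t l) :
    G.distOn F s t ≤ G.walkWeight l := by
  refine csInf_le ⟨0, ?_⟩ ⟨l, hl, rfl⟩
  rintro _ ⟨l', hl', rfl⟩
  exact walkWeight_nonneg hG ⟨hl'.1.imp fun _ _ hab => hF hab, hl'.2⟩

end Walks

namespace WDigraph

variable {V : Type} [DecidableEq V]

/-- The undirected edges underlying a set of directed edges. -/
def undirectedEdges (F : Finset (V × V)) : Finset (Sym2 V) :=
  F.image fun e => s(e.1, e.2)

theorem mem_undirectedEdges {F : Finset (V × V)} {a b : V} :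
    s(a, b) ∈ undirectedEdges F ↔ (a, b) ∈ F ∨ (b, a) ∈ F := by
  simp only [undirectedEdges, Finset.mem_image, Prod.exists, Sym2.eq_iff]
  constructor
  · rintro ⟨c, d, h, ⟨rfl, rfl⟩ | ⟨rfl, rfl⟩⟩ <;> simp [h]
  · rintro (h | h)
    · exact ⟨a, b, h, by simp⟩
    · exact ⟨b, a, h, by simp⟩

/-- The undirected graph underlying `G`, in which an edge between `a` and `b` has its weight
increased by `W * |f b - f a|`. -/
def undirected (G : WDigraph V) (f : V → ℕ) (W : ℝ) : WGraph V where
  Edge := undirectedEdges G.Edge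
  w := Sym2.lift ⟨fun a b => (if (a, b) ∈ G.Edge then G.w (a, b) else 0) +
      (if (b, a) ∈ G.Edge then G.w (b, a) else 0) + W * |(f b : ℝ) - f a|, fun a b => by
    dsimp only
    rw [abs_sub_comm, add_comm (ite _ _ _)]⟩

variable {G : WDigraph V} {f : V → ℕ} {W : ℝ}

theorem undirected_w (hf : ∀ e ∈ G.Edge, f e.1 < f e.2) {a b : V} (h : (a, b) ∈ G.Edge) :
    (G.undirected f W).w s(a, b) = G.w (a, b) + W * ((f b : ℝ) - f a) := by
  have hab : f a < f b := hf _ h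
  have hba : (b, a) ∉ G.Edge := fun h' => hab.asymm (hf _ h')
  have : (f a : ℝ) < f b := by exact_mod_cast hab
  simp [undirected, h, hba, abs_of_pos (sub_pos.2 this)]

theorem undirected_posWeights (hG : G.PosWeights) (hf : ∀ e ∈ G.Edge, f e.1 < f e.2)
    (hW : 0 ≤ W) : (G.undirected f W).PosWeights := by
  intro e he
  obtain ⟨⟨a, b⟩, h, rfl⟩ := Finset.mem_image.1 he
  have hab : (f a : ℝ) < f b := by exact_mod_cast hf _ h
  rw [undirected_w hf h]
  exact add_pos_of_pos_of_nonneg (hG _ h) (mul_nonneg hW (sub_pos.2 hab).le)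

variable {F : Finset (V × V)} {s t : V} {l : List V}

theorem _root_.IsWalkOn.undirected (hf : ∀ e ∈ G.Edge, f e.1 < f e.2) (hF : F ⊆ G.Edge)
    (hl : IsWalkOn F s t l) :
    WGraph.IsWalkOn (undirectedEdges F) s t l ∧
      (G.undirected f W).walkWeight l = G.walkWeight l + W * ((f t : ℝ) - f s) := by
  induction l generalizing s with
  | nil => simp [IsWalkOn] at hl
  | cons a l ih =>
    cases l with
    | nil =>
      obtain ⟨rfl, rfl⟩ := isWalkOn_singleton_iff.1 hl
      simp [WGraph.isWalkOn_singleton_iff, WGraph.walkWeight, WDigraph.walkWeight]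
    | cons b l =>
      obtain ⟨rfl, hab, hl⟩ := isWalkOn_cons_cons_iff.1 hl
      obtain ⟨h, hw⟩ := ih hl
      refine ⟨WGraph.isWalkOn_cons_cons_iff.2 ⟨rfl, mem_undirectedEdges.2 (.inl hab), h⟩, ?_⟩
      rw [WGraph.walkWeight_cons_cons, WDigraph.walkWeight_cons_cons, hw,
        undirected_w hf (hF hab)]
      ring

/-- A walk in the undirected graph either follows the orientation of `G`, or pays the extra cost
of going back. -/
theorem isWalkOn_or_le_walkWeight (hG : G.PosWeights) (hf : ∀ e ∈ G.Edge, f e.1 < f e.2)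
    (hW : 0 ≤ W) (hF : F ⊆ G.Edge) (hl : WGraph.IsWalkOn (undirectedEdges F) s t l) :
    IsWalkOn F s t l ∨
      W * ((f t : ℝ) - f s) + 2 * W ≤ (G.undirected f W).walkWeight l := by
  induction l generalizing s with
  | nil => simp [WGraph.IsWalkOn] at hl
  | cons a l ih =>
    cases l with
    | nil => exact .inl (isWalkOn_singleton_iff.2 (WGraph.isWalkOn_singleton_iff.1 hl))
    | cons b l =>
      obtain ⟨rfl, hab, hl⟩ := WGraph.isWalkOn_cons_cons_iff.1 hl
      rw [WGraph.walkWeight_cons_cons]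
      rcases mem_undirectedEdges.1 hab with hab | hba
      · refine (ih hl).imp (fun h => isWalkOn_cons_cons_iff.2 ⟨rfl, hab, h⟩) fun h => ?_
        have := hG _ (hF hab)
        rw [undirected_w hf (hF hab)]
        linarith
      · right
        have hlt : (f b : ℝ) + 1 ≤ f a := by exact_mod_cast hf _ (hF hba)
        have hpos := hG _ (hF hba)
        have hrest : W * ((f t : ℝ) - f b) ≤ (G.undirected f W).walkWeight (b :: l) := by
          rcases ih hl with h | h
          · rw [(h.undirected hf hF).2]
            linarith [walkWeight_nonneg hG (h.mono hF)]
          · linarith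
        rw [Sym2.eq_swap, undirected_w hf (hF hba)]
        linarith [mul_le_mul_of_nonneg_left hlt hW]

theorem undirectedEdges_mono {F F' : Finset (V × V)} (h : F ⊆ F') :
    undirectedEdges F ⊆ undirectedEdges F' :=
  Finset.image_subset_image h

theorem distOn_undirected (hG : G.PosWeights) (hf : ∀ e ∈ G.Edge, f e.1 < f e.2)
    (hW : 0 ≤ W) (hF : F ⊆ G.Edge) (hl : IsWalkOn F s t l) (hlW : G.walkWeight l ≤ 2 * W) :
    (G.undirected f W).distOn (undirectedEdges F) s t =
      G.distOn F s t + W * ((f t : ℝ) - f s) := by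
  apply le_antisymm
  · rw [← sub_le_iff_le_add]
    refine le_csInf ⟨_, l, hl, rfl⟩ ?_
    rintro _ ⟨l', hl', rfl⟩
    obtain ⟨h, hw⟩ := hl'.undirected (W := W) hf hF
    rw [sub_le_iff_le_add, ← hw]
    exact WGraph.distOn_le (undirected_posWeights hG hf hW) (undirectedEdges_mono hF) h
  · refine le_csInf ⟨_, l, (hl.undirected (W := W) hf hF).1, rfl⟩ ?_
    rintro _ ⟨l', hl', rfl⟩
    rcases isWalkOn_or_le_walkWeight hG hf hW hF hl' with h | h
    · rw [(h.undirected hf hF).2]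
      linarith [distOn_le hG hF h]
    · linarith [distOn_le hG hF hl]

theorem card_le_card_undirectedEdges (hf : ∀ e ∈ G.Edge, f e.1 < f e.2) (hF : F ⊆ G.Edge) :
    F.card ≤ (undirectedEdges F).card := by
  refine (Finset.card_image_of_injOn ?_).ge
  rintro ⟨a, b⟩ hab ⟨c, d⟩ hcd h
  rcases Sym2.eq_iff.1 h with ⟨rfl, rfl⟩ | ⟨rfl, rfl⟩
  · rfl
  · exact absurd (hf _ (hF hab)) (hf _ (hF hcd)).asymm

/-- The orientation of an exact preserver of the undirected graph is an exact preserver. -/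
theorem isExactPreserver_of_undirected {P : Finset (V × V)} (hG : G.PosWeights)
    (hf : ∀ e ∈ G.Edge, f e.1 < f e.2) (hW : 0 ≤ W) (hF : F ⊆ G.Edge)
    (hP : ∀ q ∈ P, ∃ l, IsWalkOn G.Edge q.1 q.2 l ∧ G.walkWeight l < 2 * W)
    (h : (G.undirected f W).IsExactPreserver (undirectedEdges F) P) :
    G.IsExactPreserver F P := by
  refine ⟨hF, fun q hq => ?_⟩
  obtain ⟨l, hl, hlW⟩ := hP q hq
  obtain ⟨⟨l₀, hl₀⟩, hdist⟩ := h.2 q hq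
  have hE : (G.undirected f W).dist q.1 q.2 = G.dist q.1 q.2 + W * ((f q.2 : ℝ) - f q.1) :=
    distOn_undirected hG hf hW subset_rfl hl hlW.le
  have hlt : (G.undirected f W).distOn (undirectedEdges F) q.1 q.2 <
      W * ((f q.2 : ℝ) - f q.1) + 2 * W := by
    have : G.dist q.1 q.2 ≤ G.walkWeight l := distOn_le hG subset_rfl hl
    linarith
  unfold WGraph.distOn at hlt
  obtain ⟨_, ⟨l', hl', rfl⟩, hl'W⟩ := exists_lt_of_csInf_lt (by exact ⟨_, l₀, hl₀, rfl⟩) hlt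
  have hwalk : IsWalkOn F q.1 q.2 l' :=
    (isWalkOn_or_le_walkWeight hG hf hW hF hl').resolve_right hl'W.not_ge
  refine ⟨⟨l', hwalk⟩, ?_⟩
  have hweight := (hwalk.undirected (W := W) hf hF).2
  have := distOn_undirected hG hf hW hF hwalk (by linarith)
  linarith

theorem exists_eq_undirectedEdges {F' : Finset (Sym2 V)} (h : F' ⊆ undirectedEdges G.Edge) :
    ∃ F ⊆ G.Edge, undirectedEdges F = F' := by
  obtain ⟨F, hF, rfl⟩ := Finset.subset_image_iff.1 h
  exact ⟨F, by exact_mod_cast hF, rfl⟩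

end WDigraph

theorem WGraph.isExactPreserver_edge {V : Type} {G : WGraph V} {P : Finset (V × V)}
    (hP : ∀ q ∈ P, G.Reachable q.1 q.2) : G.IsExactPreserver G.Edge P :=
  ⟨subset_rfl, fun q hq => ⟨hP q hq, rfl⟩⟩

theorem bddAbove_minPresU (n p : ℕ) :
    BddAbove {k | ∃ G : WGraph (Fin n), G.PosWeights ∧
      ∃ P : Finset (Fin n × Fin n), P.card = p ∧ (∀ q ∈ P, G.Reachable q.1 q.2) ∧
        minPresU n G P = k} := by
  refine ⟨Fintype.card (Sym2 (Fin n)), ?_⟩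
  rintro _ ⟨G, -, P, -, hP, rfl⟩
  calc minPresU n G P ≤ G.Edge.card := Nat.sInf_le ⟨_, WGraph.isExactPreserver_edge hP, rfl⟩
    _ ≤ Fintype.card (Sym2 (Fin n)) := Finset.card_le_univ _

/-- `DADP(n,p) ≤ UDP(n,p)`. -/
theorem dadp_le_udp : ∀ n p : ℕ, 1 ≤ n → 1 ≤ p → DADP n p ≤ UDP n p := by
  intro n p _ _
  refine csSup_le' ?_
  rintro _ ⟨G, hG, ⟨f, hf⟩, P, hp, hP, rfl⟩
  choose! l hl using hP
  have hnonneg : ∀ q ∈ P, 0 ≤ G.walkWeight (l q) :=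
    fun q hq => WDigraph.walkWeight_nonneg hG (hl q hq)
  set W : ℝ := 1 + ∑ q ∈ P, G.walkWeight (l q) with hWdef
  have hsum := Finset.sum_nonneg hnonneg
  have hW : 0 ≤ W := by linarith
  have hP' : ∀ q ∈ P, ∃ l, IsWalkOn G.Edge q.1 q.2 l ∧ G.walkWeight l < 2 * W := fun q hq =>
    ⟨l q, hl q hq, by linarith [Finset.single_le_sum hnonneg hq]⟩
  have hreach : ∀ q ∈ P, (G.undirected f W).Reachable q.1 q.2 := fun q hq =>
    ⟨l q, ((hl q hq).undirected (W := W) hf subset_rfl).1⟩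
  obtain ⟨F', hF', hcard⟩ : minPresU n (G.undirected f W) P ∈ _ :=
    Nat.sInf_mem ⟨_, _, WGraph.isExactPreserver_edge hreach, rfl⟩
  obtain ⟨F, hF, rfl⟩ := WDigraph.exists_eq_undirectedEdges hF'.1
  calc minPresD n G P ≤ F.card :=
        Nat.sInf_le ⟨F, WDigraph.isExactPreserver_of_undirected hG hf hW hF hP' hF', rfl⟩
    _ ≤ (WDigraph.undirectedEdges F).card := WDigraph.card_le_card_undirectedEdges hf hF
    _ = minPresU n (G.undirected f W) P := hcard
    _ ≤ UDP n p := le_csSup (bddAbove_minPresU n p)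
        ⟨_, WDigraph.undirected_posWeights hG hf hW, P, hp, hreach, rfl⟩
end

section
/- Let G be a directed positively weighted graph, P a set of demand pairs, and π(·,·) a consistent tiebreaking scheme for (G,P) such that the paths in π(P) are pairwise edge-disjoint. Then for any two distinct paths π₁, π₂ ∈ π(P): if the vertices of V(π₁) ∩ V(π₂) listed in the order they appear along π₁ are v₁,…,v_k, then they appear along π₂ in exactly the reverse order v_k,…,v₁. -/
open Finset

/-- The list of (directed) edges of a path given by its vertex list. -/
def pathEdges {V : Type} (l : List V) : List (V × V) := l.zip l.tail

/-- A tiebreaking scheme: a fixed shortest path (a simple walk achieving the distance)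
for each demand pair of `P`. -/
structure TBScheme {V : Type} (G : WDigraph V) (P : Finset (V × V)) where
  path : V × V → List V
  walk : ∀ q ∈ P, G.IsWalk q.1 q.2 (path q)
  nodup : ∀ q ∈ P, (path q).Nodup
  shortest : ∀ q ∈ P, G.walkWeight (path q) = G.dist q.1 q.2

/-- `x` strictly precedes `y` on the list `l`. -/
def Precedes {V : Type} (l : List V) (x y : V) : Prop :=
  ∃ i j : Fin l.length, i < j ∧ l.get i = x ∧ l.get j = y

/-- The segment of `l` from (the first occurrence of) `x` to (the last occurrence of) `y`. -/
def seg {V : Type} [DecidableEq V] (l : List V) (x y : V) : List V :=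
  ((l.dropWhile fun a => decide (a ≠ x)).reverse.dropWhile fun a => decide (a ≠ y)).reverse

/-- Consistency: whenever `x` precedes `y` on two paths of the scheme,
the corresponding subpaths from `x` to `y` coincide. -/
def TBScheme.Consistent {V : Type} [DecidableEq V] {G : WDigraph V} {P : Finset (V × V)}
    (S : TBScheme G P) : Prop :=
  ∀ q₁ ∈ P, ∀ q₂ ∈ P, ∀ x y : V,
    Precedes (S.path q₁) x y → Precedes (S.path q₂) x y →
      seg (S.path q₁) x y = seg (S.path q₂) x y

/-- The paths of the scheme are pairwise edge-disjoint. -/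
def TBScheme.EdgeDisjoint {V : Type} {G : WDigraph V} {P : Finset (V × V)}
    (S : TBScheme G P) : Prop :=
  ∀ q₁ ∈ P, ∀ q₂ ∈ P, S.path q₁ ≠ S.path q₂ →
    ∀ e ∈ pathEdges (S.path q₁), e ∉ pathEdges (S.path q₂)

theorem pairwise_precedes {V : Type} (l : List V) : l.Pairwise (Precedes l) :=
  List.pairwise_iff_get.2 fun i j hij => ⟨i, j, hij, rfl, rfl⟩

theorem Precedes.asymm {V : Type} {l : List V} (hl : l.Nodup) {x y : V}
    (h : Precedes l x y) : ¬ Precedes l y x := by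
  obtain ⟨i, j, hij, rfl, rfl⟩ := h
  rintro ⟨i', j', hij', hi, hj⟩
  have h1 := hl.injective_get hi
  have h2 := hl.injective_get hj
  subst h1 h2
  exact lt_asymm hij hij'

theorem precedes_or_precedes {V : Type} {l : List V} {x y : V}
    (hx : x ∈ l) (hy : y ∈ l) (hxy : x ≠ y) : Precedes l x y ∨ Precedes l y x := by
  obtain ⟨i, rfl⟩ := List.get_of_mem hx
  obtain ⟨j, rfl⟩ := List.get_of_mem hy
  rcases lt_trichotomy i j with h | h | h
  · exact Or.inl ⟨i, j, h, rfl, rfl⟩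
  · exact absurd (congrArg l.get h) hxy
  · exact Or.inr ⟨j, i, h, rfl, rfl⟩

theorem Precedes.exists_eq_append {V : Type} {l : List V} {x y : V} (h : Precedes l x y) :
    ∃ A B C, l = A ++ x :: (B ++ y :: C) := by
  obtain ⟨i, j, hij, rfl, rfl⟩ := h
  have hj : l.get j ∈ l.drop (i + 1) :=
    List.mem_drop_iff_getElem.2 ⟨j - (i + 1), by omega, by
      simp [Nat.add_sub_cancel' (Nat.succ_le_of_lt (Fin.lt_def.1 hij))]⟩
  obtain ⟨B, C, hBC⟩ := List.append_of_mem hj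
  refine ⟨l.take i, B, C, ?_⟩
  rw [← hBC]
  simp

theorem seg_append {V : Type} [DecidableEq V] {A B C : List V} {x y : V}
    (hl : (A ++ x :: (B ++ y :: C)).Nodup) :
    seg (A ++ x :: (B ++ y :: C)) x y = x :: (B ++ [y]) := by
  have hA : ∀ a ∈ A, decide (a ≠ x) = true := by
    intro a ha
    have := (List.nodup_append.1 hl).2.2 a ha x (by simp)
    simpa using this
  have hC : ∀ a ∈ C.reverse, decide (a ≠ y) = true := by
    intro a ha
    have hl' : (y :: C).Nodup := hl.sublist (by
      refine List.Sublist.trans ?_ (List.sublist_append_right _ _)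
      exact (List.sublist_append_right _ _).trans (List.sublist_cons_self _ _))
    have hy := (List.nodup_cons.1 hl').1
    have : a ≠ y := by
      rintro rfl
      exact hy (by simpa using ha)
    simpa using this
  have h1 : (A ++ x :: (B ++ y :: C)).dropWhile (fun a => decide (a ≠ x)) =
      x :: (B ++ y :: C) := by
    rw [List.dropWhile_append_of_pos hA]
    simp
  have h2 : (x :: (B ++ y :: C)).reverse = C.reverse ++ y :: (x :: B).reverse := by
    simp
  rw [seg, h1, h2, List.dropWhile_append_of_pos hC]
  simp

theorem mem_pathEdges_append {V : Type} (A C : List V) (a b : V) :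
    (a, b) ∈ pathEdges (A ++ a :: b :: C) := by
  induction A with
  | nil => simp [pathEdges]
  | cons c A ih =>
    cases A with
    | nil => simp [pathEdges]
    | cons d A => exact List.mem_cons_of_mem _ ih

theorem exists_common_edge {V : Type} [DecidableEq V] {l₁ l₂ : List V}
    (hl₁ : l₁.Nodup) (hl₂ : l₂.Nodup) {x y : V} (h₁ : Precedes l₁ x y) (h₂ : Precedes l₂ x y)
    (hseg : seg l₁ x y = seg l₂ x y) : ∃ e ∈ pathEdges l₁, e ∈ pathEdges l₂ := by
  obtain ⟨A, B, C, rfl⟩ := h₁.exists_eq_append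
  obtain ⟨A', B', C', rfl⟩ := h₂.exists_eq_append
  rw [seg_append hl₁, seg_append hl₂] at hseg
  obtain rfl : B = B' := by simpa using hseg
  cases B with
  | nil => exact ⟨(x, y), mem_pathEdges_append _ _ _ _, mem_pathEdges_append _ _ _ _⟩
  | cons z T => exact ⟨(x, z), mem_pathEdges_append _ _ _ _, mem_pathEdges_append _ _ _ _⟩

/-- the path intersection claim — common vertices of two distinct paths of a
consistent, pairwise edge-disjoint tiebreaking scheme appear in reverse orders. -/
theorem path_intersection_claim (V : Type) [DecidableEq V] (G : WDigraph V)
    (hpos : G.PosWeights) (P : Finset (V × V)) (S : TBScheme G P)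
    (hcons : S.Consistent) (hdisj : S.EdgeDisjoint) :
    ∀ q₁ ∈ P, ∀ q₂ ∈ P, S.path q₁ ≠ S.path q₂ →
      (S.path q₂).filter (fun v => decide (v ∈ S.path q₁)) =
        ((S.path q₁).filter fun v => decide (v ∈ S.path q₂)).reverse := by
  intro q₁ h₁ q₂ h₂ hne
  have n₁ := S.nodup q₁ h₁
  have n₂ := S.nodup q₂ h₂
  have hno : ∀ x y, Precedes (S.path q₂) x y → ¬ Precedes (S.path q₁) x y := by
    intro x y hp₂ hp₁
    obtain ⟨e, he₁, he₂⟩ :=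
      exists_common_edge n₁ n₂ hp₁ hp₂ (hcons q₁ h₁ q₂ h₂ x y hp₁ hp₂)
    exact hdisj q₁ h₁ q₂ h₂ hne e he₁ he₂
  have hperm : ((S.path q₂).filter fun v => decide (v ∈ S.path q₁)).Perm
      ((S.path q₁).filter fun v => decide (v ∈ S.path q₂)).reverse := by
    rw [List.perm_ext_iff_of_nodup (n₂.filter _) (List.nodup_reverse.2 (n₁.filter _))]
    intro a
    simp [and_comm]
  refine List.Perm.eq_of_pairwise (le := fun a b => Precedes (S.path q₁) b a)
    (fun a b _ _ hab hba => absurd hba (hab.asymm n₁)) ?_ ?_ hperm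
  · refine List.Pairwise.imp_of_mem ?_
      (((pairwise_precedes (S.path q₂)).and n₂).filter _)
    rintro a b ha hb ⟨hab, hne'⟩
    have ha' : a ∈ S.path q₁ := by simpa using (List.mem_filter.1 ha).2
    have hb' : b ∈ S.path q₁ := by simpa using (List.mem_filter.1 hb).2
    exact (precedes_or_precedes ha' hb' hne').resolve_left (hno a b hab)
  · rw [List.pairwise_reverse]
    exact (pairwise_precedes (S.path q₁)).filter _
end
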